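/- arXiv:2302.02634 — 7 statements merged into one kernel-verified Lean document; each statement's English description precedes it below -/
import Mathlib

section
/- Let d ≥ 1 be an integer. For every tuple α = (α_1,…,α_d) of natural numbers with α_s ≤ d−1 for all s, the polynomial W(α) lies in the ℂ-linear span of the polynomials W(β), where β ranges over all tuples satisfying β_s ≤ s−1 for every s ∈ {1,…,d}. -/
open MvPolynomial

/-- The Wronskian-type polynomial `W(α) = Wronsk(t^{α_1}Y_1, …, t^{α_d}Y_d)|_{t=0}`:
the determinant of the `d × d` matrix whose entry in row `r` and column `s` is
`(r choose α_s) · (α_s)! · Y_s^{(r − α_s)}` if `r ≥ α_s` and `0` otherwise. -/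
noncomputable def Wy (d : ℕ) (α : Fin d → ℕ) : MvPolynomial (Fin d × ℕ) ℂ :=
  Matrix.det (Matrix.of fun r s : Fin d =>
    if α s ≤ (r : ℕ) then
      (((r : ℕ).choose (α s) * (α s).factorial : ℕ) : ℂ) • X (s, (r : ℕ) - α s)
    else 0)

namespace ArtinBasis

open Polynomial in
/-- If `∏ (X - x i) = X ^ d`, then `x j` is a root of a monic polynomial of degree `j + 1` whose
coefficients lie in the subalgebra generated by the `x i` with `i > j`. -/
theorem exists_monic_aeval_eq_zero {R A : Type*} [CommRing R] [CommRing A] [Algebra R A]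
    [Nontrivial A] {d : ℕ} (x : Fin d → A)
    (h : ∏ i, (Polynomial.X - Polynomial.C (x i)) = (Polynomial.X : A[X]) ^ d) (j : Fin d)
    (S : Subalgebra R A) (hS : ∀ i, j < i → x i ∈ S) :
    ∃ q : S[X], q.Monic ∧ q.natDegree = j + 1 ∧ Polynomial.aeval (x j) q = 0 := by
  classical
  let x' : Fin d → S := fun i => if hi : j < i then ⟨x i, hS i hi⟩ else 0
  let g : S[X] := ∏ i ∈ Finset.univ.filter (j < ·), (Polynomial.X - Polynomial.C (x' i))
  let f : A[X] := ∏ i ∈ Finset.univ.filter (¬ j < ·), (Polynomial.X - Polynomial.C (x i))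
  have hg : g.Monic := monic_prod_of_monic _ _ fun i _ => monic_X_sub_C _
  have hf : f.Monic := monic_prod_of_monic _ _ fun i _ => monic_X_sub_C _
  have hgmap : g.map (algebraMap S A) =
      ∏ i ∈ Finset.univ.filter (j < ·), (Polynomial.X - Polynomial.C (x i)) := by
    rw [Polynomial.map_prod]
    refine Finset.prod_congr rfl fun i hi => ?_
    have hi' : j < i := by simpa using hi
    simp [x', hi']
  have hqf : (Polynomial.X ^ d /ₘ g).map (algebraMap S A) = f := by
    rw [Polynomial.map_divByMonic _ hg, Polynomial.map_pow, Polynomial.map_X, ← h,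
      ← Finset.prod_filter_mul_prod_filter_not Finset.univ (j < ·), ← hgmap,
      mul_divByMonic_cancel_left _ (hg.map _)]
  have hinj : Function.Injective (algebraMap S A) := Subtype.val_injective
  refine ⟨Polynomial.X ^ d /ₘ g, ?_, ?_, ?_⟩
  · rw [hinj.monic_map_iff, hqf]
    exact hf
  · rw [← Polynomial.natDegree_map_eq_of_injective hinj, hqf,
      Polynomial.natDegree_prod_of_monic _ _ fun i _ => monic_X_sub_C _]
    simp only [Polynomial.natDegree_X_sub_C, Finset.sum_const, smul_eq_mul, mul_one, not_lt]
    rw [← Fin.card_Iic j]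
    congr 1
    ext
    simp
  · rw [← Polynomial.eval_map_algebraMap, hqf, Polynomial.eval_prod]
    exact Finset.prod_eq_zero (i := j) (by simp) (by simp)

/-- If `∏ (X - x i) = X ^ d`, then the subalgebra generated by the `x i` with `n ≤ i` is spanned
by the monomials in these `x i` in which `x i` has exponent at most `i`. -/
theorem adjoin_le_span {R A : Type*} [CommRing R] [CommRing A] [Algebra R A] [Nontrivial A]
    {d : ℕ} (x : Fin d → A)
    (h : ∏ i, (Polynomial.X - Polynomial.C (x i)) = (Polynomial.X : Polynomial A) ^ d)
    {n : ℕ} (hn : n ≤ d) :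
    Subalgebra.toSubmodule (Algebra.adjoin R (x '' {i | n ≤ (i : ℕ)})) ≤
      Submodule.span R {a | ∃ β : Fin d → ℕ, (∀ i, β i ≤ (i : ℕ)) ∧ (∀ i : Fin d, (i : ℕ) < n → β i = 0) ∧
        a = ∏ i, x i ^ β i} := by
  induction hn using Nat.decreasingInduction with
  | self =>
    have : {i : Fin d | d ≤ (i : ℕ)} = ∅ := by
      ext i
      simp
    rw [this, Set.image_empty, Algebra.adjoin_empty, Algebra.toSubmodule_bot, Submodule.one_le]
    exact Submodule.subset_span ⟨0, by simp, by simp, by simp⟩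
  | of_succ n hn ih =>
    let j : Fin d := ⟨n, hn⟩
    let S := Algebra.adjoin R (x '' {i | n + 1 ≤ (i : ℕ)})
    have hS : ∀ i, j < i → x i ∈ S := fun i hi => Algebra.subset_adjoin ⟨i, hi, rfl⟩
    obtain ⟨q, hq, hdeg, hroot⟩ := exists_monic_aeval_eq_zero x h j S hS
    have hle : Algebra.adjoin R (x '' {i | n ≤ (i : ℕ)}) ≤
        ((Polynomial.aeval (R := S) (x j)).restrictScalars R).range := by
      rw [Algebra.adjoin_le_iff]
      rintro _ ⟨i, hi, rfl⟩
      rcases (show j ≤ i from hi).eq_or_lt with rfl | hji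
      · exact ⟨Polynomial.X, by simp⟩
      · exact ⟨Polynomial.C ⟨x i, hS i hji⟩, by simp⟩
    intro y hy
    obtain ⟨p, rfl⟩ := hle hy
    have hlt : (p %ₘ q).natDegree < n + 1 := by
      have := Polynomial.natDegree_modByMonic_lt p hq (by rintro rfl; simp at hdeg)
      rwa [hdeg] at this
    change Polynomial.aeval (x j) p ∈ _
    rw [← Polynomial.aeval_modByMonic_eq_self_of_root hroot,
      Polynomial.aeval_eq_sum_range' hlt]
    refine Submodule.sum_mem _ fun k hk => ?_
    rw [Finset.mem_range] at hk
    have hmem := ih ((p %ₘ q).coeff k).2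
    rw [Algebra.smul_def]
    change ((p %ₘ q).coeff k : A) * _ ∈ _
    generalize ((p %ₘ q).coeff k : A) = a at hmem
    induction hmem using Submodule.span_induction with
    | zero => simp
    | add a b _ _ ha hb =>
      rw [add_mul]
      exact add_mem ha hb
    | smul r a _ ha =>
      rw [smul_mul_assoc]
      exact Submodule.smul_mem _ _ ha
    | mem a ha =>
      obtain ⟨β, hβ, hβ0, rfl⟩ := ha
      refine Submodule.subset_span ⟨β + Pi.single j k, fun i => ?_, fun i hi => ?_, ?_⟩
      · rcases eq_or_ne i j with rfl | hij
        · have := hβ0 j (Nat.lt_succ_self n)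
          simp only [Pi.add_apply, this, Pi.single_eq_same, j]
          omega
        · simpa [hij] using hβ i
      · have hij : i ≠ j := by
          rintro rfl
          exact lt_irrefl _ hi
        simpa [hij] using hβ0 i (by omega)
      · simp only [Pi.add_apply, pow_add, Finset.prod_mul_distrib]
        congr 1
        rw [Finset.prod_eq_single j (fun i _ hij => by simp [hij]) (by simp)]
        simp

/-- If `∏ (X - x i) = X ^ d`, then every monomial in the `x i` is a linear combination of those in
which each `x i` has exponent at most `i`. -/
theorem prod_pow_mem_span {R A : Type*} [CommRing R] [CommRing A] [Algebra R A]
    {d : ℕ} (x : Fin d → A)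
    (h : ∏ i, (Polynomial.X - Polynomial.C (x i)) = (Polynomial.X : Polynomial A) ^ d)
    (α : Fin d → ℕ) :
    ∏ i, x i ^ α i ∈
      Submodule.span R {a | ∃ β : Fin d → ℕ, (∀ i, β i ≤ (i : ℕ)) ∧ a = ∏ i, x i ^ β i} := by
  rcases subsingleton_or_nontrivial A with hA | hA
  · rw [Subsingleton.elim (∏ i, x i ^ α i) 0]
    exact zero_mem _
  · refine Submodule.span_mono ?_ (adjoin_le_span (R := R) x h d.zero_le ?_)
    · rintro a ⟨β, hβ, -, rfl⟩
      exact ⟨β, hβ, rfl⟩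
    · exact Subalgebra.prod_mem _ fun i _ =>
        Subalgebra.pow_mem _ (Algebra.subset_adjoin (Set.mem_image_of_mem x (Nat.zero_le _))) _

/-- Modulo the elementary symmetric polynomials of positive degree, every monomial is a linear
combination of those in which the `i`-th variable has exponent at most `i`. -/
theorem exists_sub_mem_span_esymm {R : Type*} [CommRing R] {d : ℕ} (α : Fin d → ℕ) :
    ∃ p ∈ Submodule.span R {p : MvPolynomial (Fin d) R |
        ∃ β : Fin d → ℕ, (∀ i, β i ≤ (i : ℕ)) ∧ p = ∏ i, X i ^ β i},
      ∏ i, X i ^ α i - p ∈ Ideal.span ((esymm (Fin d) R) '' Set.Ioi 0) := by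
  set I : Ideal (MvPolynomial (Fin d) R) := Ideal.span ((esymm (Fin d) R) '' Set.Ioi 0)
  have h : ∏ i, (Polynomial.X - Polynomial.C (Ideal.Quotient.mk I (X i))) =
      (Polynomial.X : Polynomial (MvPolynomial (Fin d) R ⧸ I)) ^ d := by
    have hprod : (∏ i : Fin d, (Polynomial.X - Polynomial.C (X i : MvPolynomial (Fin d) R))) =
        ∑ k ∈ Finset.range (d + 1),
          (-1) ^ k * (Polynomial.C (esymm (Fin d) R k) * Polynomial.X ^ (d - k)) := by
      have := Multiset.prod_X_sub_X_eq_sum_esymm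
        (Finset.univ.val.map (X : Fin d → MvPolynomial (Fin d) R))
      rw [Multiset.map_map] at this
      simpa only [Multiset.card_map, Finset.card_val, Finset.card_fin,
        ← esymm_eq_multiset_esymm] using! this
    have := congrArg (Polynomial.map (Ideal.Quotient.mk I)) hprod
    rw [Polynomial.map_prod, Polynomial.map_sum, Finset.sum_eq_single 0] at this
    · simpa using this
    · intro k _ hk
      have : Ideal.Quotient.mk I (esymm (Fin d) R k) = 0 :=
        Ideal.Quotient.eq_zero_iff_mem.2 (Ideal.subset_span ⟨k, Nat.pos_of_ne_zero hk, rfl⟩)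
      simp [this]
    · simp
  have hmem := prod_pow_mem_span (R := R) (fun i => Ideal.Quotient.mk I (X i)) h α
  have himage : {a | ∃ β : Fin d → ℕ, (∀ i, β i ≤ (i : ℕ)) ∧
      a = ∏ i, Ideal.Quotient.mk I (X i) ^ β i} = (Ideal.Quotient.mkₐ R I).toLinearMap ''
        {p | ∃ β : Fin d → ℕ, (∀ i, β i ≤ (i : ℕ)) ∧ p = ∏ i, X i ^ β i} := by
    ext a
    constructor
    · rintro ⟨β, hβ, rfl⟩
      exact ⟨_, ⟨β, hβ, rfl⟩, by simp⟩
    · rintro ⟨_, ⟨β, hβ, rfl⟩, rfl⟩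
      exact ⟨β, hβ, by simp⟩
  rw [himage, Submodule.span_image] at hmem
  obtain ⟨p, hp, hpα⟩ := hmem
  refine ⟨p, hp, Ideal.Quotient.eq.1 ?_⟩
  simpa using hpα.symm

end ArtinBasis

namespace Wronskian

open scoped Matrix

variable {d : ℕ}

/-- The matrix whose determinant is `Wy d α`. -/
noncomputable def wyMatrix (α : Fin d → ℕ) :
    Matrix (Fin d) (Fin d) (MvPolynomial (Fin d × ℕ) ℂ) :=
  Matrix.of fun r s : Fin d =>
    if α s ≤ (r : ℕ) then
      (((r : ℕ).choose (α s) * (α s).factorial : ℕ) : ℂ) • X (s, (r : ℕ) - α s)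
    else 0

/-- The matrix of multiplication by `t` on the derivatives at `t = 0`. -/
def mulT (d : ℕ) (A : Type*) [Semiring A] : Matrix (Fin d) (Fin d) A :=
  Matrix.of fun r c => if (r : ℕ) = c + 1 then ((r : ℕ) : A) else 0

theorem mulT_mul_wyMatrix (α : Fin d → ℕ) :
    mulT d _ * wyMatrix α = wyMatrix (α + 1) := by
  ext1 r s
  rw [Matrix.mul_apply]
  obtain ⟨r, hr⟩ := r
  cases r with
  | zero => simp [mulT, wyMatrix]
  | succ r =>
    rw [Finset.sum_eq_single ⟨r, by omega⟩]
    · simp only [mulT, wyMatrix, Matrix.of_apply, Pi.add_apply, Pi.one_apply, if_true,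
        Nat.add_le_add_iff_right, Nat.add_sub_add_right, mul_ite, mul_zero]
      congr 1
      rw [← nsmul_eq_mul, ← Nat.cast_smul_eq_nsmul ℂ, smul_smul, ← Nat.cast_mul, ← mul_assoc,
        Nat.add_one_mul_choose_eq, Nat.factorial_succ, mul_assoc]
    · intro c _ hc
      have : r ≠ c := fun h => hc (Fin.ext h.symm)
      simp [mulT, this]
    · simp

theorem det_one_add_smul_mulT {A : Type*} [CommRing A] (z : A) :
    (1 + z • mulT d A).det = 1 := by
  rw [Matrix.det_of_isLowerTriangular]
  · simp [mulT]
  · intro r c hrc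
    have hrc : (r : ℕ) < c := hrc
    have h1 : r ≠ c := fun h => by simp [h] at hrc
    have h2 : (r : ℕ) ≠ c + 1 := by omega
    simp [mulT, h1, h2]

theorem sum_X_pow_mul_C_wy (α : Fin d → ℕ) :
    ∑ S : Finset (Fin d), Polynomial.X ^ S.card *
      Polynomial.C (Wy d (α + S.piecewise (1 : Fin d → ℕ) 0)) = Polynomial.C (Wy d α) := by
  let P := Polynomial (MvPolynomial (Fin d × ℕ) ℂ)
  let M (β : Fin d → ℕ) : Matrix (Fin d) (Fin d) P := (wyMatrix β).map Polynomial.C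
  have hdet (β : Fin d → ℕ) : (M β).det = Polynomial.C (Wy d β) :=
    (RingHom.map_det Polynomial.C (wyMatrix β)).symm
  have hT : mulT d P * M α = M (α + 1) := by
    have : mulT d P = (mulT d _).map Polynomial.C := by
      ext1 r c
      by_cases h : (r : ℕ) = c + 1 <;> simp [mulT, h]
    simp only [M]
    rw [this, ← Matrix.map_mul, mulT_mul_wyMatrix]
  have hmul : ((1 + (Polynomial.X : P) • mulT d P) * M α).det = Polynomial.C (Wy d α) := by
    rw [Matrix.det_mul, det_one_add_smul_mulT, one_mul, hdet]
  let D := (Matrix.detRowAlternating (n := Fin d) (R := P)).toMultilinearMap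
  let N (β : Fin d → ℕ) : Fin d → Fin d → P := fun s r => M β r s
  have hD (β : Fin d → ℕ) : D (N β) = Polynomial.C (Wy d β) :=
    (Matrix.det_transpose (M β)).trans (hdet β)
  have hsum : D ((fun s => (Polynomial.X : P) • N (α + 1) s) + N α) = Polynomial.C (Wy d α) := by
    rw [← hmul, add_mul, one_mul, Matrix.smul_mul, hT, add_comm (M α), ← Matrix.det_transpose]
    rfl
  rw [← hsum, MultilinearMap.map_add_univ]
  refine Finset.sum_congr rfl fun S _ => ?_
  have hrow : S.piecewise (fun s => (Polynomial.X : P) • N (α + 1) s) (N α) =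
      S.piecewise (fun s => (Polynomial.X : P) • N (α + S.piecewise (1 : Fin d → ℕ) 0) s)
        (N (α + S.piecewise (1 : Fin d → ℕ) 0)) := by
    ext1 s
    by_cases hs : s ∈ S
    · simp only [Finset.piecewise_eq_of_mem _ _ _ hs]
      ext1 r
      simp [N, M, wyMatrix, hs]
    · simp only [Finset.piecewise_eq_of_notMem _ _ _ hs]
      ext1 r
      simp [N, M, wyMatrix, hs]
  rw [hrow, MultilinearMap.map_piecewise_smul D (fun _ => Polynomial.X), Finset.prod_const,
    smul_eq_mul, hD]

theorem sum_wy_eq_zero (α : Fin d → ℕ) {k : ℕ} (hk : 0 < k) :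
    ∑ S ∈ Finset.powersetCard k Finset.univ, Wy d (α + S.piecewise (1 : Fin d → ℕ) 0) = 0 := by
  have := congrArg (Polynomial.coeff · k) (sum_X_pow_mul_C_wy α)
  simp only [Polynomial.finsetSum_coeff, Polynomial.coeff_C, hk.ne', if_false,
    Polynomial.coeff_mul_C, Polynomial.coeff_X_pow, ite_mul, one_mul,
    zero_mul] at this
  rw [← this, ← Finset.sum_filter]
  refine Finset.sum_congr ?_ fun _ _ => rfl
  ext S
  simp [eq_comm]

/-- The linear map sending the monomial with exponents `α` to `Wy d α`. -/
noncomputable def ofMonomial (d : ℕ) :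
    MvPolynomial (Fin d) ℂ →ₗ[ℂ] MvPolynomial (Fin d × ℕ) ℂ :=
  (basisMonomials (Fin d) ℂ).constr ℂ fun α => Wy d α

theorem ofMonomial_prod (α : Fin d → ℕ) : ofMonomial d (∏ i, X i ^ α i) = Wy d α := by
  have : ∏ i, (X i : MvPolynomial (Fin d) ℂ) ^ α i =
      basisMonomials (Fin d) ℂ (Finsupp.equivFunOnFinite.symm α) := by
    rw [coe_basisMonomials]
    beta_reduce
    rw [monomial_eq, Finsupp.prod_fintype _ _ (by simp)]
    simp
  rw [this, ofMonomial, Module.Basis.constr_basis]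
  rfl

theorem ofMonomial_mul_esymm (p : MvPolynomial (Fin d) ℂ) {k : ℕ} (hk : 0 < k) :
    ofMonomial d (p * esymm (Fin d) ℂ k) = 0 := by
  induction p using MvPolynomial.induction_on' with
  | add p q hp hq => rw [add_mul, map_add, hp, hq, add_zero]
  | monomial α c =>
    rw [monomial_eq, Finsupp.prod_fintype _ _ (by simp), mul_assoc, ← smul_eq_C_mul, map_smul,
      esymm, Finset.mul_sum, map_sum]
    rw [← smul_zero c, ← sum_wy_eq_zero α hk]
    congr 1
    refine Finset.sum_congr rfl fun S _ => ?_
    rw [← ofMonomial_prod]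
    congr 1
    simp only [Pi.add_apply, pow_add, Finset.prod_mul_distrib]
    congr 1
    rw [← Finset.prod_subset S.subset_univ (fun i _ hi => by simp [hi])]
    exact Finset.prod_congr rfl fun i hi => by simp [hi]

theorem ofMonomial_eq_zero {p : MvPolynomial (Fin d) ℂ}
    (hp : p ∈ Ideal.span ((esymm (Fin d) ℂ) '' Set.Ioi 0)) : ofMonomial d p = 0 := by
  induction hp using Submodule.closure_induction with
  | zero => exact map_zero _
  | add p q _ _ hp hq => rw [map_add, hp, hq, add_zero]
  | smul_mem p q hq =>
    obtain ⟨k, hk, rfl⟩ := hq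
    exact ofMonomial_mul_esymm p hk

end Wronskian

/-- For every tuple `α` with `α_s ≤ d − 1` for all `s`, the polynomial `W(α)` lies in the span of
the polynomials `W(β)` with `β_s ≤ s − 1` for all `s` (0-indexed: `β s ≤ s`). -/
theorem wronskian_mem_span_reduced (d : ℕ) (hd : 1 ≤ d) (α : Fin d → ℕ)
    (hα : ∀ s, α s ≤ d - 1) :
    Wy d α ∈ Submodule.span ℂ
      {P | ∃ β : Fin d → ℕ, (∀ s : Fin d, β s ≤ (s : ℕ)) ∧ P = Wy d β} := by
  obtain ⟨p, hp, hpα⟩ := ArtinBasis.exists_sub_mem_span_esymm (R := ℂ) α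
  have heq := Wronskian.ofMonomial_eq_zero hpα
  rw [map_sub, Wronskian.ofMonomial_prod, sub_eq_zero] at heq
  rw [heq]
  have hmem := Submodule.mem_map_of_mem (f := Wronskian.ofMonomial d) hp
  rw [← Submodule.span_image] at hmem
  refine Submodule.span_mono ?_ hmem
  rintro _ ⟨_, ⟨β, hβ, rfl⟩, rfl⟩
  exact ⟨β, hβ, Wronskian.ofMonomial_prod β⟩
end

section
/- Let d ≥ 1 be an integer and let I ⊆ ℂ[X_1,…,X_d] be the ideal generated by the power sums S_ℓ := X_1^ℓ + … + X_d^ℓ for ℓ = 1,…,d. Then the quotient ring ℂ[X_1,…,X_d]/I is a finite-dimensional ℂ-vector space of dimension exactly d!. -/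
open MvPolynomial

/-- The ideal of `ℂ[X_1, …, X_d]` generated by the power sums
`S_ℓ = X_1^ℓ + … + X_d^ℓ`, for `1 ≤ ℓ ≤ d`. -/
noncomputable def powerSumIdeal (d : ℕ) : Ideal (MvPolynomial (Fin d) ℂ) :=
  Ideal.span {S | ∃ ℓ : ℕ, 1 ≤ ℓ ∧ ℓ ≤ d ∧ S = ∑ i, X i ^ ℓ}

open Polynomial in
/-- `S` is the universal `R`-algebra over which `f` splits as `∏ i, (X - x i)`. -/
structure IsUniversalSplitting {R S : Type} [CommRing R] [CommRing S] [Algebra R S]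
    (f : R[X]) {n : ℕ} (x : Fin n → S) : Prop where
  map_eq : f.map (algebraMap R S) = ∏ i, (Polynomial.X - Polynomial.C (x i))
  adjoin_eq_top : Algebra.adjoin R (Set.range x) = ⊤
  exists_lift : ∀ (B : Type) [CommRing B] [Algebra R B] (y : Fin n → B),
    f.map (algebraMap R B) = ∏ i, (Polynomial.X - Polynomial.C (y i)) →
      ∃ φ : S →ₐ[R] B, ∀ i, φ (x i) = y i

open Polynomial in
theorem IsUniversalSplitting.cons {R R' S : Type} [CommRing R] [CommRing R'] [CommRing S]
    [Algebra R R'] [Algebra R' S] [Algebra R S] [IsScalarTower R R' S]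
    {f : R[X]} {a : R'} {g : R'[X]}
    (hfg : f.map (algebraMap R R') = (Polynomial.X - Polynomial.C a) * g)
    (ha : Algebra.adjoin R {a} = ⊤)
    (hlift : ∀ (B : Type) [CommRing B] [Algebra R B] (b : B), aeval b f = 0 →
      ∃ φ : R' →ₐ[R] B, φ a = b)
    {n : ℕ} {x : Fin n → S} (hx : IsUniversalSplitting g x) :
    IsUniversalSplitting f (Fin.cons (algebraMap R' S a) x : Fin (n + 1) → S) where
  map_eq := by
    rw [IsScalarTower.algebraMap_eq R R' S, ← Polynomial.map_map, hfg, Polynomial.map_mul,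
      hx.map_eq, Fin.prod_univ_succ]
    simp
  adjoin_eq_top := by
    set T := Algebra.adjoin R (Set.range (Fin.cons (algebraMap R' S a) x : Fin (n + 1) → S))
      with hT
    have hR' (r : R') : algebraMap R' S r ∈ T := by
      have hle : Algebra.adjoin R {a} ≤ T.comap (IsScalarTower.toAlgHom R R' S) := by
        rw [Algebra.adjoin_le_iff, Set.singleton_subset_iff]
        exact Algebra.subset_adjoin ⟨0, by simp⟩
      rw [ha] at hle
      exact hle (Algebra.mem_top (x := r))
    refine Algebra.eq_top_iff.2 fun s ↦ ?_
    have hs : s ∈ Algebra.adjoin R' (Set.range x) := hx.adjoin_eq_top ▸ Algebra.mem_top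
    induction hs using Algebra.adjoin_induction with
    | mem s hs =>
      obtain ⟨i, rfl⟩ := hs
      exact Algebra.subset_adjoin ⟨i.succ, by simp⟩
    | algebraMap r => exact hR' r
    | add _ _ _ _ h₁ h₂ => exact add_mem h₁ h₂
    | mul _ _ _ _ h₁ h₂ => exact mul_mem h₁ h₂
  exists_lift B _ _ y hy := by
    rw [Fin.prod_univ_succ] at hy
    obtain ⟨ψ, hψ⟩ := hlift B (y 0) (by
      rw [Polynomial.aeval_def, ← Polynomial.eval_map, hy]
      simp)
    let : Algebra R' B := ψ.toRingHom.toAlgebra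
    have : IsScalarTower R R' B := IsScalarTower.of_algHom ψ
    have hψ' : algebraMap R' B a = y 0 := hψ
    obtain ⟨φ, hφ⟩ := hx.exists_lift B (fun i ↦ y i.succ) (by
      rw [IsScalarTower.algebraMap_eq R R' B, ← Polynomial.map_map, hfg, Polynomial.map_mul,
        Polynomial.map_sub, Polynomial.map_X, Polynomial.map_C, hψ'] at hy
      exact (monic_X_sub_C (y 0)).isRegular.left hy)
    refine ⟨φ.restrictScalars R, Fin.cases ?_ fun i ↦ ?_⟩
    · simpa using hψ'
    · simpa using hφ i

open Polynomial in
/-- Every monic polynomial of degree `n` has a universal splitting algebra, and this algebra is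
free of rank `n!`. -/
theorem exists_isUniversalSplitting (n : ℕ) (R : Type) [CommRing R] [Nontrivial R] (f : R[X])
    (hf : f.Monic) (hn : f.natDegree = n) :
    ∃ (S : Type) (_ : CommRing S) (_ : Algebra R S) (x : Fin n → S),
      Module.Free R S ∧ Module.Finite R S ∧ Module.finrank R S = n.factorial ∧
        IsUniversalSplitting f x := by
  induction n generalizing R with
  | zero =>
    have hf1 : f = 1 := hf.natDegree_eq_zero.1 hn
    refine ⟨R, inferInstance, inferInstance, Fin.elim0, inferInstance, inferInstance, by simp,
      by simp [hf1], Algebra.eq_top_iff.2 fun r ↦ Subalgebra.algebraMap_mem _ r,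
      fun B _ _ y _ ↦ ⟨Algebra.ofId R B, fun i ↦ i.elim0⟩⟩
  | succ n ih =>
    have hfree : Module.Free R (AdjoinRoot f) := hf.free_adjoinRoot
    have hfin : Module.Finite R (AdjoinRoot f) := hf.finite_adjoinRoot
    have hrank : Module.finrank R (AdjoinRoot f) = n + 1 := by
      rw [(AdjoinRoot.powerBasis' hf).finrank, AdjoinRoot.powerBasis'_dim, hn]
    have hnt : Nontrivial (AdjoinRoot f) :=
      Module.nontrivial_of_finrank_pos (R := R) (by omega)
    have hroot : (f.map (algebraMap R (AdjoinRoot f))).IsRoot (AdjoinRoot.root f) :=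
      AdjoinRoot.isRoot_root f
    obtain ⟨g, hfg⟩ := dvd_iff_isRoot.2 hroot
    have hg : g.Monic := by
      have := hf.map (algebraMap R (AdjoinRoot f))
      rw [hfg] at this
      exact (monic_X_sub_C _).of_mul_monic_left this
    have hgn : g.natDegree = n := by
      have h := congrArg natDegree hfg
      rw [hf.natDegree_map, (monic_X_sub_C _).natDegree_mul hg, natDegree_X_sub_C, hn] at h
      omega
    obtain ⟨S, _, _, x, hSfree, hSfin, hSrank, hx⟩ := ih (AdjoinRoot f) g hg hgn
    let : Algebra R S := Algebra.compHom S (algebraMap R (AdjoinRoot f))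
    have : IsScalarTower R (AdjoinRoot f) S := IsScalarTower.of_algebraMap_eq' rfl
    refine ⟨S, inferInstance, inferInstance, _, .trans (S := AdjoinRoot f), .trans (AdjoinRoot f) S,
      ?_, hx.cons hfg AdjoinRoot.adjoinRoot_eq_top fun B _ _ b hb ↦ ?_⟩
    · rw [← Module.finrank_mul_finrank R (AdjoinRoot f) S, hrank, hSrank, Nat.factorial_succ]
    · exact ⟨AdjoinRoot.liftAlgHom f (Algebra.ofId R B) b hb, AdjoinRoot.liftAlgHom_root f _ b hb⟩

theorem esymm_aeval_eq_zero_iff_psum_aeval_eq_zero {K B ι : Type*} [Field K] [CharZero K]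
    [CommRing B] [Algebra K B] [Fintype ι] (x : ι → B) (d : ℕ) :
    (∀ k, 1 ≤ k → k ≤ d → aeval x (esymm ι K k) = 0) ↔
      ∀ k, 1 ≤ k → k ≤ d → aeval x (psum ι K k) = 0 := by
  constructor
  · intro h k hk hkd
    rw [psum_eq_mul_esymm_sub_sum ι K k hk, map_sub, map_mul, h k hk hkd, map_sum,
      Finset.sum_eq_zero, mul_zero, sub_zero]
    rintro ⟨i, j⟩ hij
    simp only [Finset.mem_filter, Set.mem_Ioo] at hij
    simp [h i (by omega) (by omega)]
  · intro h k hk hkd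
    have hmul := congrArg (aeval x) (mul_esymm_eq_sum ι K k)
    rw [map_mul, map_mul, map_sum, Finset.sum_eq_zero, mul_zero] at hmul
    · have hunit : IsUnit (aeval x (k : MvPolynomial ι K)) := by
        have : (k : K) ≠ 0 := Nat.cast_ne_zero.2 (by omega)
        simpa using this.isUnit.map (algebraMap K B)
      exact hunit.mul_right_eq_zero.1 hmul
    · rintro ⟨i, j⟩ hij
      rw [Finset.mem_filter, Finset.HasAntidiagonal.mem_antidiagonal] at hij
      dsimp only at hij
      simp [h j (by omega) (by omega)]

theorem prod_X_sub_C_eq_X_pow_iff_esymm {B ι : Type*} (K : Type*) [CommRing K]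
    [CommRing B] [Algebra K B] [Fintype ι] (x : ι → B) :
    ∏ i, (Polynomial.X - Polynomial.C (x i)) = Polynomial.X ^ Fintype.card ι ↔
      ∀ k, 1 ≤ k → k ≤ Fintype.card ι → aeval x (esymm ι K k) = 0 := by
  set s : Multiset B := Finset.univ.val.map x with hs
  have hcard : s.card = Fintype.card ι := by simp [hs]
  have hprod : ∏ i, (Polynomial.X - Polynomial.C (x i)) =
      (s.map fun t ↦ Polynomial.X - Polynomial.C t).prod := by
    rw [hs, Multiset.map_map]
    rfl
  simp_rw [aeval_esymm_eq_multiset_esymm, hprod, ← hcard]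
  constructor
  · intro h k hk hks
    have hc := s.prod_X_sub_C_coeff (k := s.card - k) (by omega)
    rw [h, Polynomial.coeff_X_pow, if_neg (by omega), Nat.sub_sub_self hks] at hc
    exact (isUnit_one.neg.pow k).mul_right_eq_zero.1 hc.symm
  · intro h
    rw [Multiset.prod_X_sub_X_eq_sum_esymm, Finset.sum_eq_single 0]
    · simp [Multiset.esymm]
    · intro k hk hk0
      rw [h k (by omega) (by simpa [Nat.lt_succ_iff] using hk)]
      simp
    · simp

theorem prod_X_sub_C_eq_X_pow_iff_sum_pow {B ι : Type*} (K : Type*) [Field K] [CharZero K]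
    [CommRing B] [Algebra K B] [Fintype ι] (x : ι → B) :
    ∏ i, (Polynomial.X - Polynomial.C (x i)) = Polynomial.X ^ Fintype.card ι ↔
      ∀ k, 1 ≤ k → k ≤ Fintype.card ι → ∑ i, x i ^ k = 0 := by
  rw [prod_X_sub_C_eq_X_pow_iff_esymm K, esymm_aeval_eq_zero_iff_psum_aeval_eq_zero]
  simp [psum]

theorem IsUniversalSplitting.nonempty_algEquiv {d : ℕ} {S : Type} [CommRing S] [Algebra ℂ S]
    {x : Fin d → S} (hx : IsUniversalSplitting (Polynomial.X ^ d : Polynomial ℂ) x) :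
    Nonempty (S ≃ₐ[ℂ] MvPolynomial (Fin d) ℂ ⧸ powerSumIdeal d) := by
  have hsum := (prod_X_sub_C_eq_X_pow_iff_sum_pow ℂ x).1 (by simpa using hx.map_eq.symm)
  rw [Fintype.card_fin] at hsum
  obtain ⟨φ, hφ⟩ := hx.exists_lift (MvPolynomial (Fin d) ℂ ⧸ powerSumIdeal d)
    (fun i ↦ Ideal.Quotient.mkₐ ℂ _ (X i)) (by
      have h := (prod_X_sub_C_eq_X_pow_iff_sum_pow ℂ
        fun i : Fin d ↦ Ideal.Quotient.mkₐ ℂ (powerSumIdeal d) (X i)).2 fun k hk hkd ↦ by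
          simp_rw [← map_pow, ← map_sum]
          exact Ideal.Quotient.eq_zero_iff_mem.2
            (Ideal.subset_span ⟨k, hk, by simpa using hkd, rfl⟩)
      rw [h]
      simp)
  have hker : ∀ p ∈ powerSumIdeal d, aeval (R := ℂ) x p = 0 := by
    suffices powerSumIdeal d ≤ RingHom.ker (aeval (R := ℂ) x) from this
    refine Ideal.span_le.2 ?_
    rintro _ ⟨k, hk, hkd, rfl⟩
    simpa using hsum k hk hkd
  have hlift (i : Fin d) : Ideal.Quotient.liftₐ _ (aeval x) hker
      (Ideal.Quotient.mk (powerSumIdeal d) (X i)) = x i := aeval_X x i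
  refine ⟨AlgEquiv.ofAlgHom φ (Ideal.Quotient.liftₐ _ (aeval x) hker) ?_ ?_⟩
  · refine Ideal.Quotient.algHom_ext _ (MvPolynomial.algHom_ext fun i ↦ ?_)
    simp [hlift, hφ]
  · refine AlgHom.ext_of_adjoin_eq_top hx.adjoin_eq_top ?_
    rintro _ ⟨i, rfl⟩
    simpa [hφ] using hlift i

/-- The quotient `ℂ[X_1, …, X_d]/(S_1, …, S_d)` is a finite-dimensional ℂ-vector space of
dimension exactly `d!`. -/
theorem coinvariant_algebra_dim (d : ℕ) (hd : 1 ≤ d) :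
    FiniteDimensional ℂ (MvPolynomial (Fin d) ℂ ⧸ powerSumIdeal d) ∧
      Module.finrank ℂ (MvPolynomial (Fin d) ℂ ⧸ powerSumIdeal d) = d.factorial := by
  obtain ⟨S, _, _, x, -, _, hrank, hx⟩ :=
    exists_isUniversalSplitting d ℂ (Polynomial.X ^ d) (Polynomial.monic_X_pow d) (by simp)
  obtain ⟨e⟩ := hx.nonempty_algEquiv
  exact ⟨Module.Finite.equiv e.toLinearEquiv, e.toLinearEquiv.finrank_eq ▸ hrank⟩
end

section
/- Let d ≥ 1 and k ≥ 0 be integers. The ℂ-vector space of polynomials P ∈ ℂ[X_1,…,X_d] whose degree in each individual variable is at most k and which satisfy ∑_{i=1}^{d} ∂^ℓ P/∂X_i^ℓ = 0 for every ℓ ∈ {1,…,d} has dimension at most d!. -/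
open MvPolynomial

/-- The ℂ-subspace of polynomials in `ℂ[X_1, …, X_d]` of degree at most `k` in each individual
variable which satisfy the system of PDE's `∑_{i=1}^{d} ∂^ℓ P/∂X_i^ℓ = 0` for `1 ≤ ℓ ≤ d`. -/
noncomputable def pdeSpace (d k : ℕ) : Submodule ℂ (MvPolynomial (Fin d) ℂ) where
  carrier := {P | (∀ m ∈ P.support, ∀ i, m i ≤ k) ∧
    ∀ ℓ : ℕ, 1 ≤ ℓ → ℓ ≤ d →
      ∑ i, ((pderiv i).toLinearMap ^ ℓ : Module.End ℂ (MvPolynomial (Fin d) ℂ)) P = 0}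
  zero_mem' := by
    refine ⟨by simp, fun ℓ h1 h2 => by simp⟩
  add_mem' := by
    rintro a b ⟨ha1, ha2⟩ ⟨hb1, hb2⟩
    refine ⟨fun m hm i => ?_, fun ℓ h1 h2 => ?_⟩
    · rcases Finset.mem_union.1 (MvPolynomial.support_add hm) with h | h
      · exact ha1 m h i
      · exact hb1 m h i
    · simp only [map_add, Finset.sum_add_distrib, ha2 ℓ h1 h2, hb2 ℓ h1 h2, add_zero]
  smul_mem' := by
    rintro c x ⟨hx1, hx2⟩
    refine ⟨fun m hm i => hx1 m (MvPolynomial.support_smul hm) i, fun ℓ h1 h2 => ?_⟩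
    simp only [map_smul, ← Finset.smul_sum, hx2 ℓ h1 h2, smul_zero]

universe u

section CoinvariantRank

open Polynomial hiding X C aeval map eval₂ eval

theorem Polynomial.Monic.rank_adjoinRoot {K R : Type*} [Field K] [CommRing R] [Nontrivial R]
    [Algebra K R] {f : R[X]} (hf : f.Monic) :
    Module.rank K (AdjoinRoot f) = Module.rank K R * f.natDegree := by
  have := hf.free_adjoinRoot
  have h := rank_mul_rank K R (AdjoinRoot f)
  rw [← h, rank_eq_card_basis (AdjoinRoot.powerBasis' hf).basis, Fintype.card_fin,
    AdjoinRoot.powerBasis'_dim]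

/-- If a monic polynomial over `R` splits over an `R`-algebra `A` with `n` roots, and `A` is
generated by these roots over the image of `R`, then `A` has rank at most `n!` times that of `R`. -/
theorem rank_le_rank_mul_factorial {K A : Type u} [Field K] [CommRing A] [Nontrivial A]
    [Algebra K A] (s : Multiset A) (R : Type u) [CommRing R] [Algebra K R] (φ : R →ₐ[K] A)
    (f : R[X]) (hf : f.Monic) (hdeg : f.natDegree = s.card)
    (hmap : f.map (φ : R →+* A) = (s.map fun y => Polynomial.X - Polynomial.C y).prod)
    (hgen : Algebra.adjoin K ((φ.range : Set A) ∪ {y | y ∈ s}) = ⊤) :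
    Module.rank K A ≤ Module.rank K R * (s.card.factorial : Cardinal) := by
  induction s using Multiset.induction_on generalizing R with
  | empty =>
    have hsurj : Function.Surjective φ := by
      rw [← AlgHom.range_eq_top, ← hgen]
      simp only [Multiset.notMem_zero, Set.ofPred_false, Set.union_empty, Algebra.adjoin_eq]
    simpa using φ.toLinearMap.rank_le_of_surjective hsurj
  | cons y s ih =>
    have : Nontrivial R := (φ : R →+* A).domain_nontrivial
    have hroot : f.eval₂ (φ : R →+* A) y = 0 := by
      rw [← Polynomial.eval_map, hmap]
      simp
    let ψ : AdjoinRoot f →ₐ[K] A := AdjoinRoot.liftAlgHom f φ y hroot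
    have : Nontrivial (AdjoinRoot f) := (ψ : AdjoinRoot f →+* A).domain_nontrivial
    let F : (AdjoinRoot f)[X] := f.map (AdjoinRoot.of f)
    have hF : F.Monic := hf.map _
    have hFroot : F.IsRoot (AdjoinRoot.root f) := AdjoinRoot.isRoot_root f
    let g := F /ₘ (Polynomial.X - Polynomial.C (AdjoinRoot.root f))
    have hFg : (Polynomial.X - Polynomial.C (AdjoinRoot.root f)) * g = F :=
      mul_divByMonic_eq_iff_isRoot.2 hFroot
    have hg : g.Monic := (monic_X_sub_C _).of_mul_monic_left (hFg ▸ hF)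
    have hψy : ψ (AdjoinRoot.root f) = y := AdjoinRoot.liftAlgHom_root ..
    have hψof (r : R) : ψ (AdjoinRoot.of f r) = φ r := AdjoinRoot.liftAlgHom_of ..
    have hgdeg : g.natDegree = s.card := by
      rw [natDegree_divByMonic _ (monic_X_sub_C _), natDegree_X_sub_C, hf.natDegree_map, hdeg,
        Multiset.card_cons, Nat.add_sub_cancel]
    have hcomp : (ψ : AdjoinRoot f →+* A).comp (AdjoinRoot.of f) = φ := RingHom.ext hψof
    have hgmap : g.map (ψ : AdjoinRoot f →+* A) =
        (s.map fun y => Polynomial.X - Polynomial.C y).prod := by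
      apply (monic_X_sub_C y).isRegular.left
      have h := congrArg (Polynomial.map (ψ : AdjoinRoot f →+* A)) hFg
      rw [Polynomial.map_mul, Polynomial.map_map, hcomp, hmap] at h
      simpa [hψy] using h
    have hψgen : Algebra.adjoin K ((ψ.range : Set A) ∪ {y | y ∈ s}) = ⊤ := by
      rw [eq_top_iff, ← hgen, Algebra.adjoin_le_iff]
      rintro a (⟨r, rfl⟩ | ha)
      · exact Algebra.subset_adjoin (Or.inl ⟨AdjoinRoot.of f r, hψof r⟩)
      · rcases Multiset.mem_cons.1 ha with rfl | ha
        · exact Algebra.subset_adjoin (Or.inl ⟨_, hψy⟩)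
        · exact Algebra.subset_adjoin (Or.inr ha)
    refine (ih _ ψ g hg hgdeg hgmap hψgen).trans_eq ?_
    rw [hf.rank_adjoinRoot, hdeg, Multiset.card_cons, Nat.factorial_succ, Nat.cast_mul, mul_assoc]

/-- Newton's identities: if the first power sums vanish, so do the elementary symmetric ones. -/
theorem MvPolynomial.aeval_esymm_eq_zero_of_aeval_psum {σ K A : Type*} [Fintype σ] [Field K]
    [CharZero K] [CommRing A] [Algebra K A] (y : σ → A) {d : ℕ}
    (h : ∀ ℓ, 1 ≤ ℓ → ℓ ≤ d → MvPolynomial.aeval y (psum σ K ℓ) = 0) {k : ℕ} (hk : 1 ≤ k)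
    (hkd : k ≤ d) : MvPolynomial.aeval y (esymm σ K k) = 0 := by
  have newton := congrArg (MvPolynomial.aeval y) (mul_esymm_eq_sum σ K k)
  rw [map_mul, map_mul, map_sum, Finset.sum_eq_zero, mul_zero] at newton
  · rw [map_natCast, ← nsmul_eq_mul, ← Nat.cast_smul_eq_nsmul K] at newton
    exact (smul_eq_zero_iff_right (Nat.cast_ne_zero.2 (by lia))).1 newton
  · intro a ha
    simp only [Finset.mem_filter, Finset.HasAntidiagonal.mem_antidiagonal] at ha
    rw [map_mul, h a.2 (by lia) (by lia), mul_zero]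

/-- An algebra generated by `d` elements whose first `d` power sums vanish has rank at most `d!`. -/
theorem rank_le_factorial_of_psum_eq_zero {K A : Type u} [Field K] [CharZero K] [CommRing A]
    [Algebra K A] {d : ℕ} (y : Fin d → A) (hgen : Algebra.adjoin K (Set.range y) = ⊤)
    (h : ∀ ℓ, 1 ≤ ℓ → ℓ ≤ d → ∑ i, y i ^ ℓ = 0) :
    Module.rank K A ≤ (d.factorial : Cardinal) := by
  nontriviality A
  let s : Multiset A := Finset.univ.val.map y
  have hcard : s.card = d := by simp [s]
  have hesymm (k : ℕ) (hk : 1 ≤ k) (hkd : k ≤ d) : s.esymm k = 0 := by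
    rw [← MvPolynomial.aeval_esymm_eq_multiset_esymm (Fin d) K]
    refine MvPolynomial.aeval_esymm_eq_zero_of_aeval_psum y (fun ℓ h1 h2 => ?_) hk hkd
    simpa [MvPolynomial.psum] using h ℓ h1 h2
  have hprod : (s.map fun y => Polynomial.X - Polynomial.C y).prod = Polynomial.X ^ d := by
    rw [Multiset.prod_X_sub_X_eq_sum_esymm, Finset.sum_eq_single 0]
    · simp [hcard, Multiset.esymm]
    · intro j hj hj0
      rw [hesymm j (by lia) (by simp [hcard] at hj; lia)]
      simp
    · simp
  have key := rank_le_rank_mul_factorial s K (Algebra.ofId K A) (Polynomial.X ^ d) (monic_X_pow d)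
    (by rw [natDegree_X_pow, hcard]) (by rw [hprod]; simp) (by
      rw [eq_top_iff, ← hgen]
      refine Algebra.adjoin_mono ?_
      rintro _ ⟨i, rfl⟩
      exact Or.inr (by simp [s]))
  simpa [hcard] using key

open scoped IsMulCommutative in
/-- If the first `d` power sums of `d` commuting endomorphisms vanish, then the algebra they
generate has rank at most `d!`. -/
theorem rank_adjoin_le_factorial {K V : Type u} [Field K] [CharZero K] [AddCommGroup V]
    [Module K V] {d : ℕ} (D : Fin d → Module.End K V) (hD : ∀ i j, Commute (D i) (D j))
    (h : ∀ ℓ, 1 ≤ ℓ → ℓ ≤ d → ∑ i, D i ^ ℓ = 0) :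
    Module.rank K (Algebra.adjoin K (Set.range D)) ≤ (d.factorial : Cardinal) := by
  have : IsMulCommutative (Algebra.adjoin K (Set.range D)) :=
    Algebra.isMulCommutative_adjoin K (by
      rintro _ ⟨i, rfl⟩ _ ⟨j, rfl⟩
      exact hD i j)
  refine rank_le_factorial_of_psum_eq_zero (K := K)
    (fun i => (⟨D i, Algebra.subset_adjoin ⟨i, rfl⟩⟩ : Algebra.adjoin K (Set.range D)))
    ?_ fun ℓ h1 h2 => Subtype.ext ?_
  · rw [← Algebra.adjoin_adjoin_coe_preimage (R := K) (s := Set.range D)]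
    congr 1
    ext a
    simp [Subtype.ext_iff]
  · simpa using h ℓ h1 h2

/-- If the first `d` power sums of `d` commuting endomorphisms of `V` vanish, and some linear form
on `V` is nonzero on the orbit of every nonzero vector under the algebra they generate, then `V`
has rank at most `d!`. -/
theorem rank_le_factorial_of_commuting {K V : Type u} [Field K] [CharZero K] [AddCommGroup V]
    [Module K V] {d : ℕ} (D : Fin d → Module.End K V) (hD : ∀ i j, Commute (D i) (D j))
    (h : ∀ ℓ, 1 ≤ ℓ → ℓ ≤ d → ∑ i, D i ^ ℓ = 0) (ε : V →ₗ[K] K)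
    (hε : ∀ v, (∀ a ∈ Algebra.adjoin K (Set.range D), ε (a v) = 0) → v = 0) :
    Module.rank K V ≤ (d.factorial : Cardinal) := by
  have hrank := rank_adjoin_le_factorial D hD h
  set A := Algebra.adjoin K (Set.range D)
  have : Module.Finite K A :=
    Module.rank_lt_aleph0_iff.1 (hrank.trans_lt Cardinal.natCast_lt_aleph0)
  let pairing : V →ₗ[K] Module.Dual K A :=
    (LinearMap.compRight K ε ∘ₗ A.val.toLinearMap).flip
  have hinj : Function.Injective pairing := by
    rw [injective_iff_map_eq_zero]
    exact fun v hv => hε v fun a ha => LinearMap.congr_fun hv ⟨a, ha⟩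
  calc Module.rank K V ≤ Module.rank K (Module.Dual K A) := pairing.rank_le_of_injective hinj
    _ = Module.rank K A := by
      rw [← Module.finrank_eq_rank, ← Module.finrank_eq_rank, Subspace.dual_finrank_eq]
    _ ≤ d.factorial := hrank

end CoinvariantRank

theorem MvPolynomial.commute_pderiv {σ R : Type*} [CommRing R] (i j : σ) :
    Commute ((pderiv i).toLinearMap : Module.End R (MvPolynomial σ R))
      (pderiv j).toLinearMap := by
  classical
  have h : ⁅pderiv (R := R) i, pderiv (R := R) j⁆ = 0 := by
    refine derivation_ext fun k => ?_
    simp [Derivation.commutator_apply, pderiv_X, Pi.single_apply, apply_ite]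
  refine LinearMap.ext fun p => ?_
  have hp := DFunLike.congr_fun h p
  rw [Derivation.commutator_apply] at hp
  exact sub_eq_zero.1 hp

/-- A set of polynomials stable under partial derivatives, all of whose elements have zero constant
coefficient, contains only zero. -/
theorem MvPolynomial.eq_zero_of_forall_pderiv_mem {σ R : Type*} [CommRing R] [IsDomain R]
    [CharZero R] (N : Set (MvPolynomial σ R)) (h0 : ∀ p ∈ N, coeff 0 p = 0)
    (hN : ∀ p ∈ N, ∀ i, pderiv i p ∈ N) {p : MvPolynomial σ R} (hp : p ∈ N) : p = 0 := by
  ext m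
  rw [coeff_zero]
  induction hn : m.degree generalizing m p with
  | zero => rw [(Finsupp.degree_eq_zero_iff m).1 hn, h0 p hp]
  | succ n ih =>
    obtain ⟨i, hi⟩ : ∃ i, m i ≠ 0 := by
      by_contra! h
      rw [Finsupp.ext (g := 0) h, map_zero] at hn
      lia
    have hle : Finsupp.single i 1 ≤ m := by simpa [Nat.one_le_iff_ne_zero] using hi
    obtain ⟨m', rfl⟩ := exists_add_of_le hle
    rw [map_add, Finsupp.degree_single] at hn
    have h := ih (hN p hp i) m' (by lia)
    rw [coeff_pderiv, mul_eq_zero] at h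
    rw [add_comm]
    exact h.resolve_right (by exact_mod_cast Nat.succ_ne_zero (m' i))

theorem pderiv_mem_pdeSpace {d k : ℕ} (i : Fin d) :
    ∀ p ∈ pdeSpace d k, (pderiv i).toLinearMap p ∈ pdeSpace d k := by
  rintro p ⟨hdeg, hp⟩
  refine ⟨fun m hm j => ?_, fun ℓ h1 h2 => ?_⟩
  · have hm' : m + Finsupp.single i 1 ∈ p.support := by
      rw [mem_support_iff] at hm ⊢
      exact left_ne_zero_of_mul (coeff_pderiv p m ▸ hm)
    exact (Nat.le_add_right _ _).trans (hdeg _ hm' j)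
  · have hcomm (j : Fin d) := LinearMap.congr_fun
      ((commute_pderiv (R := ℂ) j i).pow_left ℓ).eq p
    simp only [Module.End.mul_apply] at hcomm
    simp only [hcomm, ← map_sum, hp ℓ h1 h2, map_zero]

/-- The partial derivative, as an endomorphism of `pdeSpace d k`. -/
noncomputable def pderivEnd {d : ℕ} (k : ℕ) (i : Fin d) : Module.End ℂ (pdeSpace d k) :=
  (pderiv i).toLinearMap.restrict (pderiv_mem_pdeSpace i)

theorem coe_pderivEnd_apply {d k : ℕ} (i : Fin d) (p : pdeSpace d k) :
    (pderivEnd k i p : MvPolynomial (Fin d) ℂ) = (pderiv i).toLinearMap (p : MvPolynomial _ ℂ) :=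
  LinearMap.coe_restrict_apply ..

theorem coe_pderivEnd_pow_apply {d k : ℕ} (i : Fin d) (ℓ : ℕ) (p : pdeSpace d k) :
    ((pderivEnd k i ^ ℓ) p : MvPolynomial (Fin d) ℂ) =
      ((pderiv i).toLinearMap ^ ℓ : Module.End ℂ (MvPolynomial (Fin d) ℂ)) p := by
  rw [pderivEnd, Module.End.pow_restrict]
  rfl

theorem commute_pderivEnd {d k : ℕ} (i j : Fin d) : Commute (pderivEnd k i) (pderivEnd k j) := by
  refine LinearMap.ext fun p => Subtype.ext ?_
  simp only [Module.End.mul_apply, coe_pderivEnd_apply]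
  exact LinearMap.congr_fun (commute_pderiv i j).eq (p : MvPolynomial (Fin d) ℂ)

theorem sum_pderivEnd_pow {d k ℓ : ℕ} (h1 : 1 ≤ ℓ) (h2 : ℓ ≤ d) :
    ∑ i : Fin d, pderivEnd k i ^ ℓ = 0 := by
  refine LinearMap.ext fun p => Subtype.ext ?_
  simpa [LinearMap.sum_apply, coe_pderivEnd_pow_apply] using p.2.2 ℓ h1 h2

/-- The space of polynomials of degree at most `k` in each variable killed by all the operators
`∑_i ∂^ℓ/∂X_i^ℓ`, `1 ≤ ℓ ≤ d`, has dimension at most `d!`. -/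
theorem pdeSpace_rank_le (d k : ℕ) (hd : 1 ≤ d) :
    Module.rank ℂ (pdeSpace d k) ≤ (d.factorial : Cardinal) := by
  refine rank_le_factorial_of_commuting (pderivEnd k) commute_pderivEnd
    (fun ℓ h1 h2 => sum_pderivEnd_pow h1 h2) (lcoeff ℂ 0 ∘ₗ (pdeSpace d k).subtype) fun p hp => ?_
  refine Subtype.ext (eq_zero_of_forall_pderiv_mem
    ((↑) '' {q : pdeSpace d k | ∀ a ∈ Algebra.adjoin ℂ (Set.range (pderivEnd k)),
      coeff 0 (a q : MvPolynomial (Fin d) ℂ) = 0}) ?_ ?_ ⟨p, hp, rfl⟩)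
  · rintro _ ⟨q, hq, rfl⟩
    exact hq 1 (one_mem _)
  · rintro _ ⟨q, hq, rfl⟩ i
    exact ⟨pderivEnd k i q,
      fun a ha => hq _ (mul_mem ha (Algebra.subset_adjoin ⟨i, rfl⟩)), rfl⟩
end

section
/- Let d ≥ 1 be an integer and let N be a ℂ-linear endomorphism of ℂ^d that is nilpotent of nilpotency index d, i.e. N^d = 0 and N^{d−1} ≠ 0. Then for every integer i with 0 ≤ i ≤ d and all vectors v_1,…,v_{d−i+1} ∈ ℂ^d, one has ∑_{α} (N^{α_1}v_1) ∧ (N^{α_2}v_2) ∧ ⋯ ∧ (N^{α_{d−i+1}}v_{d−i+1}) = 0 in the (d−i+1)-st exterior power of ℂ^d, where the sum runs over all tuples α = (α_1,…,α_{d−i+1}) ∈ ℕ^{d−i+1} with α_1 + … + α_{d−i+1} = i. -/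
section WedgeSum

variable {K V : Type*} [Field K] [AddCommGroup V] [Module K V]

/-- The sum of the wedge products `N^{α_1}v_1 ∧ ⋯ ∧ N^{α_k}v_k` over all tuples `α` of sum `n`,
i.e. the complete homogeneous symmetric polynomial of degree `n` in the commuting actions of `N`
on the `k` tensor slots. -/
noncomputable def wedgeSum (N : Module.End K V) (k n : ℕ) (v : Fin k → V) : ExteriorAlgebra K V :=
  ∑ α ∈ Finset.Nat.antidiagonalTuple k n, ExteriorAlgebra.ιMulti K k (fun m => (N ^ α m) (v m))

variable (N : Module.End K V) {k n : ℕ}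

theorem wedgeSum_cons (u : V) (v : Fin k → V) :
    wedgeSum N (k + 1) n (Fin.cons u v) =
      ∑ p ∈ Finset.HasAntidiagonal.antidiagonal n, ExteriorAlgebra.ι K ((N ^ p.1) u) * wedgeSum N k p.2 v := by
  simp only [wedgeSum, Finset.mul_sum]
  rw [Finset.sum_sigma']
  refine Finset.sum_bij' (fun α _ => ⟨(α 0, ∑ m, α (Fin.succ m)), fun m : Fin k => α m.succ⟩)
    (fun x _ => Fin.cons (α := fun _ => ℕ) x.1.1 x.2) ?_ ?_ ?_ ?_ ?_
  · intro α hα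
    rw [Finset.Nat.mem_antidiagonalTuple, Fin.sum_univ_succ] at hα
    simp [Finset.Nat.mem_antidiagonalTuple, hα]
  · rintro ⟨⟨a, b⟩, β⟩ h
    simp only [Finset.mem_sigma, Finset.HasAntidiagonal.mem_antidiagonal, Finset.Nat.mem_antidiagonalTuple] at h
    simp [Finset.Nat.mem_antidiagonalTuple, Fin.sum_univ_succ, h.2, h.1]
  · intro α _
    exact Fin.cons_self_tail α
  · rintro ⟨⟨a, b⟩, β⟩ h
    simp only [Finset.mem_sigma, Finset.HasAntidiagonal.mem_antidiagonal, Finset.Nat.mem_antidiagonalTuple] at h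
    simp [h.2]
  · intro α _
    rw [ExteriorAlgebra.ιMulti_succ_apply]
    rfl

theorem wedgeSum_cons_add (u u' : V) (v : Fin k → V) :
    wedgeSum N (k + 1) n (Fin.cons (u + u') v) =
      wedgeSum N (k + 1) n (Fin.cons u v) + wedgeSum N (k + 1) n (Fin.cons u' v) := by
  simp only [wedgeSum_cons, map_add, add_mul, Finset.sum_add_distrib]

theorem wedgeSum_cons_smul (c : K) (u : V) (v : Fin k → V) :
    wedgeSum N (k + 1) n (Fin.cons (c • u) v) = c • wedgeSum N (k + 1) n (Fin.cons u v) := by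
  simp only [wedgeSum_cons, map_smul, smul_mul_assoc, Finset.smul_sum]

theorem wedgeSum_succ_cons (u : V) (v : Fin k → V) :
    wedgeSum N (k + 1) (n + 1) (Fin.cons u v) =
      ExteriorAlgebra.ι K u * wedgeSum N k (n + 1) v +
        wedgeSum N (k + 1) n (Fin.cons (N u) v) := by
  simp only [wedgeSum_cons, Finset.Nat.sum_antidiagonal_succ, pow_zero, Module.End.one_apply,
    pow_succ, Module.End.mul_apply]

theorem wedgeSum_comp_swap (v : Fin k → V) {a b : Fin k} (hab : a ≠ b) :
    wedgeSum N k n (v ∘ Equiv.swap a b) = -wedgeSum N k n v := by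
  rw [wedgeSum, wedgeSum, ← Finset.sum_neg_distrib]
  refine Finset.sum_equiv ((Equiv.swap a b).arrowCongr (Equiv.refl ℕ)) ?_ ?_
  · intro α
    simp only [Finset.Nat.mem_antidiagonalTuple, Equiv.arrowCongr_apply, Equiv.coe_refl,
      Function.comp_apply, id_eq]
    rw [Equiv.sum_comp (Equiv.swap a b).symm α]
  · intro α _
    rw [← AlternatingMap.map_swap _ _ hab]
    congr 1
    ext1 m
    simp

theorem wedgeSum_cons_cons_swap (u w : V) (v : Fin k → V) :
    wedgeSum N (k + 2) n (Fin.cons u (Fin.cons w v)) =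
      -wedgeSum N (k + 2) n (Fin.cons w (Fin.cons u v)) := by
  rw [← wedgeSum_comp_swap N _ (zero_ne_one : (0 : Fin (k + 2)) ≠ 1)]
  congr 1
  ext1 m
  refine Fin.cases ?_ (fun m => Fin.cases ?_ (fun m => ?_) m) m
  · rw [Function.comp_apply, Equiv.swap_apply_left, ← Fin.succ_zero_eq_one]
    rfl
  · rw [Function.comp_apply, Fin.succ_zero_eq_one, Equiv.swap_apply_right]
    rfl
  · rw [Function.comp_apply, Equiv.swap_apply_of_ne_of_ne (Fin.succ_ne_zero _)
      (by simp [Fin.ext_iff])]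
    simp

/-- If `N ^ d = 0` and `N` has a cyclic vector, then `wedgeSum N k n` vanishes for
`k + n = d + 1`, `k ≥ 1`. -/
theorem wedgeSum_eq_zero [CharZero K] {d : ℕ} (hN : N ^ d = 0) (e : V)
    (he : Submodule.span K (Set.range fun j : ℕ => (N ^ j) e) = ⊤) (hkn : k + n = d)
    (v : Fin (k + 1) → V) : wedgeSum N (k + 1) n v = 0 := by
  induction k generalizing n with
  | zero =>
    obtain rfl : n = d := by omega
    simp [wedgeSum, hN]
  | succ k ih =>
    have hcons (u : V) (w : Fin (k + 1) → V) :
        wedgeSum N (k + 2) n (Fin.cons (N u) w) = wedgeSum N (k + 2) (n + 1) (Fin.cons u w) := by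
      rw [wedgeSum_succ_cons, ih (by omega), mul_zero, zero_add]
    have hshift (u w : V) (r : Fin k → V) :
        wedgeSum N (k + 2) n (Fin.cons (N u) (Fin.cons w r)) =
          wedgeSum N (k + 2) n (Fin.cons u (Fin.cons (N w) r)) := by
      rw [hcons, wedgeSum_cons_cons_swap, ← hcons, ← wedgeSum_cons_cons_swap]
    have hpow (j : ℕ) (u w : V) (r : Fin k → V) :
        wedgeSum N (k + 2) n (Fin.cons ((N ^ j) u) (Fin.cons w r)) =
          wedgeSum N (k + 2) n (Fin.cons u (Fin.cons ((N ^ j) w) r)) := by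
      induction j generalizing u w with
      | zero => rfl
      | succ j ihj =>
        rw [pow_succ, Module.End.mul_apply, ihj, hshift, ← Module.End.mul_apply, ← pow_succ',
          pow_succ]
    have hbasis (a b : ℕ) (r : Fin k → V) :
        wedgeSum N (k + 2) n (Fin.cons ((N ^ a) e) (Fin.cons ((N ^ b) e) r)) = 0 := by
      have h : wedgeSum N (k + 2) n (Fin.cons ((N ^ a) e) (Fin.cons ((N ^ b) e) r)) =
          -wedgeSum N (k + 2) n (Fin.cons ((N ^ a) e) (Fin.cons ((N ^ b) e) r)) := by
        conv_lhs => rw [hpow, ← Module.End.mul_apply, ← pow_add, add_comm a b, pow_add,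
          Module.End.mul_apply, ← hpow, wedgeSum_cons_cons_swap]
      rw [eq_neg_iff_add_eq_zero, ← two_smul K] at h
      exact (smul_eq_zero.mp h).resolve_left two_ne_zero
    have hspan (f : V → ExteriorAlgebra K V) (hadd : ∀ x y, f (x + y) = f x + f y)
        (hsmul : ∀ (c : K) x, f (c • x) = c • f x) (h : ∀ j : ℕ, f ((N ^ j) e) = 0) (x : V) :
        f x = 0 := by
      let F : V →ₗ[K] ExteriorAlgebra K V := ⟨⟨f, hadd⟩, hsmul⟩
      have : F = 0 := LinearMap.ext_on_range he h
      exact LinearMap.congr_fun this x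
    have key (u w : V) (r : Fin k → V) :
        wedgeSum N (k + 2) n (Fin.cons u (Fin.cons w r)) = 0 := by
      refine hspan (fun u => wedgeSum N (k + 2) n (Fin.cons u (Fin.cons w r)))
        (fun _ _ => wedgeSum_cons_add ..) (fun _ _ => wedgeSum_cons_smul ..) (fun a => ?_) u
      rw [wedgeSum_cons_cons_swap, neg_eq_zero]
      exact hspan (fun w => wedgeSum N (k + 2) n (Fin.cons w (Fin.cons ((N ^ a) e) r)))
        (fun _ _ => wedgeSum_cons_add ..) (fun _ _ => wedgeSum_cons_smul ..)
        (fun b => hbasis b a r) w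
    rw [← Fin.cons_self_tail v, ← Fin.cons_self_tail (Fin.tail v)]
    exact key _ _ _

end WedgeSum

theorem linearIndependent_pow_apply_of_nilpotent {K V : Type*} [Field K] [AddCommGroup V]
    [Module K V] {N : Module.End K V} {d : ℕ} (hN : N ^ d = 0) {e : V}
    (he : (N ^ (d - 1)) e ≠ 0) : LinearIndependent K fun j : Fin d => (N ^ (j : ℕ)) e := by
  rw [Fintype.linearIndependent_iff]
  intro g hg j
  induction j using WellFoundedLT.induction with
  | ind j ih =>
    have h := congrArg (N ^ (d - 1 - j : ℕ)) hg
    rw [map_sum, map_zero, Finset.sum_eq_single j] at h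
    · rw [map_smul, ← Module.End.mul_apply, ← pow_add,
        show d - 1 - (j : ℕ) + j = d - 1 by omega] at h
      exact (smul_eq_zero.mp h).resolve_right he
    · intro l _ hl
      rcases lt_or_gt_of_ne hl with hl | hl
      · rw [ih l hl, zero_smul, map_zero]
      · have : d ≤ d - 1 - (j : ℕ) + l := by have : (j : ℕ) < l := hl; omega
        rw [map_smul, ← Module.End.mul_apply, ← pow_add, pow_eq_zero_of_le this hN,
          LinearMap.zero_apply, smul_zero]
    · simp


/-- Let `N` be a nilpotent endomorphism of `ℂ^d` of nilpotency index `d`.  For `0 ≤ i ≤ d` and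
vectors `v_1, …, v_{d−i+1}`, the sum of the wedge products
`N^{α_1}v_1 ∧ ⋯ ∧ N^{α_{d−i+1}}v_{d−i+1}` over all tuples `α` with `α_1 + … + α_{d−i+1} = i`
vanishes in the `(d−i+1)`-st exterior power of `ℂ^d`. -/
theorem sum_wedge_nilpotent_eq_zero (d i : ℕ) (hd : 1 ≤ d) (hi : i ≤ d)
    (Nl : Module.End ℂ (Fin d → ℂ)) (hNd : Nl ^ d = 0) (hNd' : Nl ^ (d - 1) ≠ 0)
    (v : Fin (d - i + 1) → (Fin d → ℂ)) :
    ∑ α ∈ Finset.Nat.antidiagonalTuple (d - i + 1) i,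
      ExteriorAlgebra.ιMulti ℂ (d - i + 1) (fun m => (Nl ^ α m) (v m)) = 0 := by
  obtain ⟨e, he⟩ : ∃ e, (Nl ^ (d - 1)) e ≠ 0 := by
    contrapose! hNd'
    exact LinearMap.ext hNd'
  have hspan : Submodule.span ℂ (Set.range fun j : Fin d => (Nl ^ (j : ℕ)) e) = ⊤ :=
    (linearIndependent_pow_apply_of_nilpotent hNd he).span_eq_top_of_card_eq_finrank' (by simp)
  refine wedgeSum_eq_zero Nl hNd e (top_le_iff.mp ?_) (Nat.sub_add_cancel hi) v
  rw [← hspan]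
  exact Submodule.span_mono (Set.range_subset_iff.mpr fun j => ⟨j, rfl⟩)
end

section
/- Let d ≥ 1 be an integer and let N be a ℂ-linear endomorphism of ℂ^d that is nilpotent of nilpotency index d (N^d = 0 and N^{d−1} ≠ 0). Let 1 ≤ i ≤ d and let β_1,…,β_{i−1} be natural numbers with β_k ≤ k−1 for each 1 ≤ k ≤ i−1. Then for all vectors v_1,…,v_d ∈ ℂ^d, ∑_{(α_i,…,α_d)} det(N^{β_1}v_1, …, N^{β_{i−1}}v_{i−1}, N^{α_i}v_i, …, N^{α_d}v_d) = 0, where the sum runs over all tuples (α_i,…,α_d) ∈ ℕ^{d−i+1} with α_i + … + α_d = i. -/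
open Polynomial in
/-- The `n`-th coefficient of a finite product of polynomials, as a sum over tuples of exponents. -/
theorem Polynomial.coeff_prod_eq_sum_antidiagonalTuple {R : Type*} [CommSemiring R] {m : ℕ}
    (p : Fin m → R[X]) (n : ℕ) :
    (∏ j, p j).coeff n =
      ∑ α ∈ Finset.Nat.antidiagonalTuple m n, ∏ j, (p j).coeff (α j) := by
  induction m generalizing n with
  | zero => cases n <;> simp [Polynomial.coeff_one]
  | succ m ih =>
    simp_rw [Fin.prod_univ_succ, Polynomial.coeff_mul, ih, Finset.mul_sum]
    rw [Finset.sum_sigma']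
    refine Finset.sum_bij' (fun x _ => Fin.cons x.1.1 x.2)
      (fun α _ => ⟨(α 0, ∑ j, Fin.tail α j), Fin.tail α⟩) ?_ ?_ ?_ ?_ ?_
    · rintro ⟨⟨a, b⟩, α⟩ h
      simpa [Finset.Nat.mem_antidiagonalTuple, Fin.sum_univ_succ, and_comm] using
        (by simp [Finset.Nat.mem_antidiagonalTuple] at h; omega : a + ∑ j, α j = n)
    · intro α h
      simpa [Finset.Nat.mem_antidiagonalTuple, Fin.sum_univ_succ, Fin.tail] using h
    · rintro ⟨⟨a, b⟩, α⟩ h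
      simp only [Finset.mem_sigma, Finset.Nat.mem_antidiagonalTuple] at h
      obtain ⟨-, rfl⟩ := h
      simp
    · intro α h
      simp
    · rintro ⟨⟨a, b⟩, α⟩ h
      simp

namespace Matrix

open Polynomial

variable {ι R : Type*} [Fintype ι] [DecidableEq ι] [CommRing R]

/-- The truncation of `(1 - X A)⁻¹ v` at degree `K`. -/
noncomputable def truncResolvent (A : Matrix ι ι R) (K : ℕ) (v : ι → R) : ι → R[X] :=
  (∑ j ∈ Finset.range K, ((X : R[X]) • A.map C) ^ j) *ᵥ (C ∘ v)

theorem coeff_truncResolvent (A : Matrix ι ι R) {K : ℕ} (hK : A ^ K = 0) (v : ι → R) (r : ι)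
    (m : ℕ) : (truncResolvent A K v r).coeff m = (A ^ m *ᵥ v) r := by
  have key : truncResolvent A K v r =
      ∑ j ∈ Finset.range K, C ((A ^ j *ᵥ v) r) * X ^ j := by
    simp only [truncResolvent, sum_mulVec, Finset.sum_apply]
    refine Finset.sum_congr rfl fun j _ => ?_
    have h : A.map C ^ j = (A ^ j).map (C : R →+* R[X]) := (Matrix.map_pow A C j).symm
    rw [_root_.smul_pow, h, smul_mulVec, Pi.smul_apply, ← RingHom.map_mulVec, smul_eq_mul,
      mul_comm]
  rw [key, finsetSum_coeff]
  simp only [coeff_C_mul_X_pow, Finset.sum_ite_eq, Finset.mem_range]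
  split_ifs with h
  · rfl
  · rw [pow_eq_zero_of_le (not_lt.mp h) hK, zero_mulVec, Pi.zero_apply]

theorem one_sub_X_smul_mulVec_truncResolvent (A : Matrix ι ι R) {K : ℕ} (hK : A ^ K = 0)
    (v : ι → R) : (1 - (X : R[X]) • A.map C) *ᵥ truncResolvent A K v = C ∘ v := by
  have h : A.map C ^ K = (A ^ K).map (C : R →+* R[X]) := (Matrix.map_pow A C K).symm
  rw [truncResolvent, mulVec_mulVec, mul_neg_geom_sum, _root_.smul_pow, h, hK]
  simp

/-- If `A` is a nilpotent matrix of size `k + n` and `i > k`, then the degree `i` complete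
homogeneous symmetric polynomial in the actions of `A` on the last `n` columns kills the
determinant. -/
theorem sum_det_pow_mulVec_eq_zero [IsDomain R] {k n d i : ℕ} (hd : d = k + n) (hki : k < i)
    (A : Matrix (Fin d) (Fin d) R) (hA : IsNilpotent A) (w v : Fin d → Fin d → R) :
    ∑ α ∈ Finset.Nat.antidiagonalTuple n i,
      det (of fun r s : Fin d =>
        (if h : (s : ℕ) < k then w s
          else A ^ α ⟨(s : ℕ) - k, by have := s.isLt; omega⟩ *ᵥ v s) r) = 0 := by
  obtain ⟨K, hK⟩ := hA
  subst hd
  let M : Matrix (Fin (k + n)) (Fin (k + n)) R[X] := of fun r s =>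
    (if (s : ℕ) < k then C ∘ w s else truncResolvent A K (v s)) r
  have hcoeff : ∑ α ∈ Finset.Nat.antidiagonalTuple n i,
      det (of fun r s : Fin (k + n) =>
        (if h : (s : ℕ) < k then w s
          else A ^ α ⟨(s : ℕ) - k, by have := s.isLt; omega⟩ *ᵥ v s) r) = M.det.coeff i := by
    simp only [det_apply, finsetSum_coeff]
    rw [Finset.sum_comm]
    refine Finset.sum_congr rfl fun σ _ => ?_
    rw [coeff_smul, ← Finset.smul_sum]
    congr 1
    simp only [M, of_apply, Fin.prod_univ_add, Fin.val_castAdd, Fin.is_lt, if_true, dite_true,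
      Fin.val_natAdd, add_lt_iff_neg_left, not_lt_zero, if_false, dite_false,
      Function.comp_apply, add_tsub_cancel_left, Fin.eta]
    rw [← map_prod, coeff_C_mul, Polynomial.coeff_prod_eq_sum_antidiagonalTuple, Finset.mul_sum]
    simp only [coeff_truncResolvent A hK]
  have hdeg : ((1 - (X : R[X]) • A.map C) * M).det.natDegree ≤ k := by
    have hcol : ∀ r s, (((1 - (X : R[X]) • A.map C) * M) r s).natDegree ≤
        if (s : ℕ) < k then 1 else 0 := by
      intro r s
      have hrs : ((1 - (X : R[X]) • A.map C) * M) r s =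
          ((1 - (X : R[X]) • A.map C) *ᵥ fun r => M r s) r := rfl
      rw [hrs]
      by_cases hs : (s : ℕ) < k
      · have hM : (fun r => M r s) = C ∘ w s := by
          funext r
          simp [M, hs]
        rw [hM, if_pos hs, sub_mulVec, one_mulVec, smul_mulVec, Pi.sub_apply,
          Pi.smul_apply, ← RingHom.map_mulVec, Function.comp_apply, smul_eq_mul]
        compute_degree
      · have hM : (fun r => M r s) = truncResolvent A K (v s) := by
          funext r
          simp [M, hs]
        rw [hM, if_neg hs, one_sub_X_smul_mulVec_truncResolvent A hK]
        simp
    rw [det_apply]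
    refine natDegree_sum_le_of_forall_le _ _ fun σ _ => ?_
    refine (natDegree_smul_le _ _).trans ((natDegree_prod_le _ _).trans ?_)
    refine (Finset.sum_le_sum fun s _ => hcol (σ s) s).trans ?_
    rw [Fin.sum_univ_add]
    simp
  have hunit : IsUnit (1 - (X : R[X]) • A.map C).det :=
    isUnit_charpolyRev_of_isNilpotent ⟨K, hK⟩
  rw [hcoeff]
  refine coeff_eq_zero_of_natDegree_lt (lt_of_le_of_lt ?_ hki)
  rcases eq_or_ne M.det 0 with h0 | h0
  · simp [h0]
  · rwa [det_mul, natDegree_mul hunit.ne_zero h0, natDegree_eq_zero_of_isUnit hunit,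
      zero_add] at hdeg

end Matrix

/-- Let `N` be a nilpotent endomorphism of `ℂ^d` of nilpotency index `d`, let `1 ≤ i ≤ d`, and
let `β_1, …, β_{i−1}` satisfy `β_k ≤ k − 1` (0-indexed: column `s` with `s + 1 < i` carries
exponent `β s ≤ s`).  Then for all vectors `v_1, …, v_d`, the sum over all tuples
`(α_i, …, α_d)` with `α_i + … + α_d = i` of the determinants
`det(N^{β_1}v_1, …, N^{β_{i−1}}v_{i−1}, N^{α_i}v_i, …, N^{α_d}v_d)` vanishes. -/
theorem sum_det_nilpotent_eq_zero (d i : ℕ) (hd : 1 ≤ d) (hi1 : 1 ≤ i) (hid : i ≤ d)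
    (Nl : Module.End ℂ (Fin d → ℂ)) (hNd : Nl ^ d = 0) (hNd' : Nl ^ (d - 1) ≠ 0)
    (β : Fin d → ℕ) (hβ : ∀ s : Fin d, (s : ℕ) + 1 < i → β s ≤ (s : ℕ))
    (v : Fin d → (Fin d → ℂ)) :
    ∑ α ∈ Finset.Nat.antidiagonalTuple (d - i + 1) i,
      Matrix.det (Matrix.of fun r s : Fin d =>
        (if h : (s : ℕ) < i - 1 then (Nl ^ β s) (v s)
          else (Nl ^ α ⟨(s : ℕ) - (i - 1), by have := s.isLt; omega⟩) (v s)) r) = 0 := by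
  have htoMatrix (m : ℕ) : LinearMap.toMatrix' (Nl ^ m) = LinearMap.toMatrix' Nl ^ m :=
    map_pow LinearMap.toMatrixAlgEquiv' Nl m
  have hpow (m : ℕ) (u : Fin d → ℂ) :
      (Nl ^ m) u = Matrix.mulVec (LinearMap.toMatrix' Nl ^ m) u := by
    rw [← htoMatrix, LinearMap.toMatrix'_mulVec]
  have hnil : IsNilpotent (LinearMap.toMatrix' Nl) :=
    ⟨d, by rw [← htoMatrix, hNd, map_zero]⟩
  have hmain := Matrix.sum_det_pow_mulVec_eq_zero (k := i - 1) (n := d - i + 1) (i := i)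
    (by omega) (by omega) (LinearMap.toMatrix' Nl) hnil (fun s => (Nl ^ β s) (v s)) v
  simpa only [← hpow] using hmain
end

section
/- Let d ≥ 1 be an integer and let N be a ℂ-linear endomorphism of ℂ^d that is nilpotent of nilpotency index d (N^d = 0 and N^{d−1} ≠ 0). For a tuple α = (α_1,…,α_d) of natural numbers let P_α : (ℂ^d)^d → ℂ be the function (v_1,…,v_d) ↦ det(N^{α_1}v_1, …, N^{α_d}v_d). Then for every tuple α with α_s ≤ d−1 for all s, the function P_α lies in the ℂ-linear span, inside the ℂ-module of all functions (ℂ^d)^d → ℂ, of the set of functions P_β where β ranges over all tuples satisfying β_s ≤ s−1 for every s ∈ {1,…,d}. -/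
/-- The function `P_α : (v_1, …, v_d) ↦ det(N^{α_1}v_1, …, N^{α_d}v_d)`. -/
noncomputable def Pfun (d : ℕ) (Nl : Module.End ℂ (Fin d → ℂ)) (α : Fin d → ℕ) :
    (Fin d → (Fin d → ℂ)) → ℂ :=
  fun v => Matrix.det (Matrix.of fun r s : Fin d => (Nl ^ α s) (v s) r)

open Polynomial in
/-- If a monic polynomial over `R` splits over `A` with roots `x i`, then every monomial in the `x i`
is an `R`-linear combination of the monomials `∏ i, x i ^ β i` with `β i ≤ i`. -/
theorem prod_pow_mem_span_of_prod_X_sub_C_eq_map.{u} {A : Type u} [CommRing A]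
    {d : ℕ} :
    ∀ {R : Type u} [CommRing R] [Algebra R A] (p : R[X]) (x : Fin d → A),
      p.Monic → p.map (algebraMap R A) = ∏ i, (X - C (x i)) → ∀ α : Fin d → ℕ,
      ∏ i, x i ^ α i ∈ Submodule.span R
        {y | ∃ β : Fin d → ℕ, (∀ i : Fin d, β i ≤ i) ∧ y = ∏ i, x i ^ β i} := by
  rcases subsingleton_or_nontrivial A with _ | _
  · intro R _ _ p x _ _ α
    rw [Subsingleton.elim (∏ i, x i ^ α i) 0]
    exact zero_mem _
  induction d with
  | zero =>
    intro R _ _ p x _ _ α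
    exact Submodule.subset_span ⟨α, fun i => i.elim0, rfl⟩
  | succ d ih =>
    intro R _ _ p x hp hpx α
    set z := x (Fin.last d) with hz
    let S := Algebra.adjoin R {z}
    let z' : S := ⟨z, Algebra.self_mem_adjoin_singleton R z⟩
    have hroot : aeval z p = 0 := by
      rw [aeval_def, ← eval_map, hpx, eval_prod]
      exact Finset.prod_eq_zero (Finset.mem_univ (Fin.last d)) (by simp [hz])
    have hroot' : aeval z' p = 0 := by
      apply Subtype.val_injective
      simp [z', hroot]
    have hdeg : p.natDegree = d + 1 := by
      rw [← hp.natDegree_map (algebraMap R A), hpx]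
      simp
    let q : S[X] := p.map (algebraMap R S) /ₘ (X - C z')
    have hq : (X - C z') * q = p.map (algebraMap R S) := by
      rw [mul_divByMonic_eq_iff_isRoot, IsRoot.def, eval_map, ← aeval_def, hroot']
    have hqm : q.Monic :=
      (monic_X_sub_C z').of_mul_monic_left (hq ▸ hp.map _)
    have hqx : q.map (algebraMap S A) = ∏ i : Fin d, (X - C (x i.castSucc)) := by
      apply (monic_X_sub_C z).isRegular.left
      have h := congrArg (Polynomial.map (algebraMap S A)) hq
      rw [Polynomial.map_mul, Polynomial.map_map, ← IsScalarTower.algebraMap_eq, hpx,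
        Fin.prod_univ_castSucc] at h
      simpa [z', mul_comm] using h
    have hspan : Submodule.span R {y : S | ∃ k ≤ d, y = z' ^ k} = ⊤ := by
      rw [eq_top_iff]
      rintro ⟨y, hy⟩ -
      obtain ⟨f, rfl⟩ : ∃ f : R[X], aeval z f = y := by
        rwa [← AlgHom.mem_range, ← Algebra.adjoin_singleton_eq_range_aeval]
      have hf : (⟨aeval z f, hy⟩ : S) = aeval z' (f %ₘ p) := by
        apply Subtype.val_injective
        have h1 := aeval_algebraMap_apply A z' (f %ₘ p)
        exact (aeval_modByMonic_eq_self_of_root hroot).symm.trans h1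
      rw [hf, aeval_eq_sum_range]
      refine Submodule.sum_mem _ fun k hk =>
        Submodule.smul_mem _ _ (Submodule.subset_span ⟨k, ?_, rfl⟩)
      have := natDegree_modByMonic_lt f hp (by rintro rfl; simp at hdeg)
      rw [Finset.mem_range] at hk
      omega
    have h := Submodule.smul_mem _ (z' ^ α (Fin.last d))
      (ih q (fun i => x i.castSucc) hqm hqx (fun i => α i.castSucc))
    rw [← Submodule.restrictScalars_mem R, ← Submodule.span_smul_of_span_eq_top hspan] at h
    rw [Fin.prod_univ_castSucc, mul_comm]
    refine Submodule.span_mono ?_ h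
    rintro _ ⟨_, ⟨k, hk, rfl⟩, _, ⟨β, hβ, rfl⟩, rfl⟩
    refine ⟨Fin.snoc β k, ?_, ?_⟩
    · intro i
      induction i using Fin.lastCases with
      | last => simpa using hk
      | cast i => simpa using hβ i
    · simp [Fin.prod_univ_castSucc, z', Algebra.smul_def, mul_comm, hz]

open Polynomial in
theorem prod_X_sub_C_eq_X_pow_of_map_esymm_eq_zero {σ R A : Type*} [Fintype σ] [CommRing R]
    [CommRing A] (f : MvPolynomial σ R →+* A)
    (hf : ∀ j ≠ 0, f (MvPolynomial.esymm σ R j) = 0) :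
    ∏ i : σ, (X - C (f (MvPolynomial.X i))) = X ^ Fintype.card σ := by
  have h := Multiset.prod_X_sub_X_eq_sum_esymm
    (Finset.univ.val.map fun i : σ => (MvPolynomial.X i : MvPolynomial σ R))
  rw [← MvPolynomial.esymm_eq_multiset_esymm, Finset.sum_range_succ', Multiset.map_map] at h
  simpa [Polynomial.map_prod, Polynomial.map_sum, hf] using congrArg (Polynomial.map f) h

theorem LinearMap.det_one_add_smul_of_isNilpotent {K V : Type*} [Field K] [AddCommGroup V]
    [Module K V] [FiniteDimensional K V] {N : Module.End K V} (hN : IsNilpotent N) (t : K) :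
    LinearMap.det (1 + t • N) = 1 := by
  have h : IsNilpotent (-(t • N)) := (hN.smul t).neg
  have h1 := congrArg (Polynomial.eval 1) h.charpoly_eq_X_pow_finrank
  rw [LinearMap.eval_charpoly] at h1
  simpa using h1

theorem Pfun_eq_det (d : ℕ) (N : Module.End ℂ (Fin d → ℂ)) (α : Fin d → ℕ)
    (v : Fin d → Fin d → ℂ) :
    Pfun d N α v = (Pi.basisFun ℂ (Fin d)).det fun s => (N ^ α s) (v s) := by
  rw [Pi.basisFun_det, Matrix.detRowAlternating, Pfun, ← Matrix.det_transpose]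
  rfl

open Polynomial in
/-- Elementary symmetric functions of positive degree in the actions of a nilpotent `N` on the
columns annihilate the determinant. -/
theorem sum_powersetCard_Pfun_eq_zero {d : ℕ} {N : Module.End ℂ (Fin d → ℂ)}
    (hN : IsNilpotent N) (α : Fin d → ℕ) {j : ℕ} (hj : j ≠ 0) :
    ∑ t ∈ Finset.univ.powersetCard j, Pfun d N (fun s => α s + if s ∈ t then 1 else 0) = 0 := by
  classical
  funext v
  set D := (Pi.basisFun ℂ (Fin d)).det
  let w : Fin d → Fin d → ℂ := fun s => (N ^ α s) (v s)
  have hw (t : Finset (Fin d)) : Pfun d N (fun s => α s + if s ∈ t then 1 else 0) v =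
      D (t.piecewise (fun s => N (w s)) w) := by
    rw [Pfun_eq_det]
    congr 1
    funext s
    by_cases hs : s ∈ t <;> simp [hs, w, pow_succ']
  have hpoly : ∑ t : Finset (Fin d), C (D (t.piecewise (fun s => N (w s)) w)) * X ^ t.card =
      C (D w) := by
    apply Polynomial.funext
    intro c
    have h := Module.Basis.det_comp (Pi.basisFun ℂ (Fin d)) (1 + c • N) w
    rw [LinearMap.det_one_add_smul_of_isNilpotent hN, one_mul] at h
    rw [eval_C, ← h, eval_finsetSum]
    have h2 : ((1 + c • N : Module.End ℂ (Fin d → ℂ)) ∘ w) = (fun s => c • N (w s)) + w := by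
      funext s
      simp [add_comm]
    rw [h2, AlternatingMap.map_add_univ]
    refine Finset.sum_congr rfl fun t _ => ?_
    have h3 := D.toMultilinearMap.map_piecewise_smul (fun _ => c)
      (t.piecewise (fun s => N (w s)) w) t
    have h4 : t.piecewise (fun s => c • N (w s)) w = t.piecewise
        (fun s => c • t.piecewise (fun s => N (w s)) w s) (t.piecewise (fun s => N (w s)) w) := by
      funext s
      by_cases hs : s ∈ t <;> simp [hs]
    rw [h4]
    refine Eq.trans ?_ h3.symm
    rw [eval_mul, eval_C, eval_pow, eval_X, Finset.prod_const, smul_eq_mul, mul_comm]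
    rfl
  have h := congrArg (fun p => p.coeff j) hpoly
  simp only [finsetSum_coeff, coeff_C_mul_X_pow, coeff_C, hj, if_false] at h
  rw [Finset.sum_apply, Finset.powersetCard_eq_filter, Finset.sum_filter]
  simpa [hw, eq_comm] using h

/-- For a nilpotent endomorphism `N` of `ℂ^d` of nilpotency index `d` and any tuple `α` with
`α_s ≤ d − 1` for all `s`, the function `P_α` lies in the ℂ-linear span of the functions `P_β`
with `β_s ≤ s − 1` for all `s` (0-indexed: `β s ≤ s`). -/
theorem Pfun_mem_span_reduced (d : ℕ) (hd : 1 ≤ d)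
    (Nl : Module.End ℂ (Fin d → ℂ)) (hNd : Nl ^ d = 0) (hNd' : Nl ^ (d - 1) ≠ 0)
    (α : Fin d → ℕ) (hα : ∀ s, α s ≤ d - 1) :
    Pfun d Nl α ∈ Submodule.span ℂ
      {g : (Fin d → (Fin d → ℂ)) → ℂ |
        ∃ β : Fin d → ℕ, (∀ s : Fin d, β s ≤ (s : ℕ)) ∧ g = Pfun d Nl β} := by
  have hN : IsNilpotent Nl := ⟨d, hNd⟩
  let L : MvPolynomial (Fin d) ℂ →ₗ[ℂ] ((Fin d → (Fin d → ℂ)) → ℂ) :=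
    (MvPolynomial.basisMonomials (Fin d) ℂ).constr ℂ fun m => Pfun d Nl m
  have hLm (m : Fin d →₀ ℕ) : L (MvPolynomial.monomial m 1) = Pfun d Nl m := by
    have := (MvPolynomial.basisMonomials (Fin d) ℂ).constr_basis ℂ (fun m => Pfun d Nl m) m
    rwa [MvPolynomial.coe_basisMonomials] at this
  have hL (β : Fin d → ℕ) : L (∏ i, MvPolynomial.X i ^ β i) = Pfun d Nl β := by
    have := hLm (Finsupp.equivFunOnFinite.symm β)
    rw [MvPolynomial.monomial_eq, Finsupp.prod_fintype _ _ (by simp)] at this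
    simpa using this
  let I : Ideal (MvPolynomial (Fin d) ℂ) :=
    Ideal.span {f | ∃ j ≠ 0, f = MvPolynomial.esymm (Fin d) ℂ j}
  have hI : I.restrictScalars ℂ ≤ LinearMap.ker L := by
    intro f hf
    replace hf : f ∈ I := hf
    suffices ∀ g, L (g * f) = 0 by simpa using this 1
    induction hf using Submodule.span_induction with
    | zero => simp
    | add f g _ _ hf hg => intro k; rw [mul_add, map_add, hf, hg, add_zero]
    | smul a f _ hf => intro k; rw [smul_eq_mul, ← mul_assoc, hf]
    | mem f hf =>
      obtain ⟨j, hj, rfl⟩ := hf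
      intro g
      induction g using MvPolynomial.induction_on' with
      | add p q hp hq => rw [add_mul, map_add, hp, hq, add_zero]
      | monomial m a =>
        rw [← mul_one a, ← smul_eq_mul (a := a), ← MvPolynomial.smul_monomial, smul_mul_assoc, map_smul,
          MvPolynomial.esymm_eq_sum_monomial, Finset.mul_sum, map_sum]
        simp only [MvPolynomial.monomial_mul, one_mul, hLm]
        rw [← smul_zero a, ← sum_powersetCard_Pfun_eq_zero hN m hj]
        congr! 3 with t ht
        funext s
        simp [Finsupp.single_apply]
  let π := Ideal.Quotient.mkₐ ℂ I
  let B : Set (MvPolynomial (Fin d) ℂ) :=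
    {y | ∃ β : Fin d → ℕ, (∀ i : Fin d, β i ≤ i) ∧ y = ∏ i, MvPolynomial.X i ^ β i}
  have hprod : (Polynomial.X ^ d : Polynomial ℂ).map (algebraMap ℂ (_ ⧸ I)) =
      ∏ i : Fin d, (Polynomial.X - Polynomial.C (π (MvPolynomial.X i))) := by
    simpa using (prod_X_sub_C_eq_X_pow_of_map_esymm_eq_zero π.toRingHom fun j hj =>
      Ideal.Quotient.eq_zero_iff_mem.mpr (Ideal.subset_span ⟨j, hj, rfl⟩)).symm
  have hmem := prod_pow_mem_span_of_prod_X_sub_C_eq_map _ _ (Polynomial.monic_X_pow d) hprod α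
  have hmem' : π (∏ i, MvPolynomial.X i ^ α i) ∈ (Submodule.span ℂ B).map π.toLinearMap := by
    rw [Submodule.map_span]
    simp only [map_prod, map_pow]
    refine Submodule.span_mono ?_ hmem
    rintro _ ⟨β, hβ, rfl⟩
    exact ⟨_, ⟨β, hβ, rfl⟩, by simp⟩
  obtain ⟨y, hy, hyα⟩ := hmem'
  have hyL : L y = Pfun d Nl α := by
    rw [← hL, ← sub_eq_zero, ← map_sub]
    exact hI (Ideal.Quotient.eq.mp hyα)
  rw [← hyL]
  have := Submodule.mem_map_of_mem (f := L) hy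
  rw [Submodule.map_span] at this
  refine Submodule.span_mono ?_ this
  rintro _ ⟨_, ⟨β, hβ, rfl⟩, rfl⟩
  exact ⟨β, hβ, hL β⟩
end

section
/- Let N ≥ 1 and d ≥ 1 be integers and let 𝒫 be a Wronskian datum of degree d with concatenated exponent tuple (α_1,…,α_d). Then d(d−1)/2 − (α_1+…+α_d) ≤ ⌊N·d²/(2(N+1))⌋, i.e. the weight of W_𝒫 is at most the floor of (1 − 1/(N+1))·d²/2. -/
open MvPolynomial

/-- A Wronskian datum of degree `d` in variables indexed by `Fin (N+1)`.  It is encoded by the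
nondecreasing list `n_1 ≤ … ≤ n_d` of indices (`i` repeated `m_i` times) together with the
concatenated tuple `(α_1, …, α_d)` of exponents; within each block `{s | n s = i}` the exponents
are strictly increasing and bounded by `m_0 + m_1 + … + m_i = #{t | n t ≤ i}`. -/
structure WronskDatum (N d : ℕ) where
  n : Fin d → Fin (N + 1)
  a : Fin d → ℕ
  mono : Monotone n
  strictOnBlocks : ∀ s t : Fin d, s < t → n s = n t → a s < a t
  bound : ∀ s : Fin d, a s < (Finset.univ.filter fun t => n t ≤ n s).card

/-- The polynomial `W_𝒫`: the determinant of the `d × d` matrix whose entry in row `r` and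
column `s` is `(r choose α_s) · (α_s)! · X_{n_s}^{(r − α_s)}` if `r ≥ α_s` and `0` otherwise. -/
noncomputable def Wpoly {N d : ℕ} (D : WronskDatum N d) : MvPolynomial (Fin (N + 1) × ℕ) ℂ :=
  Matrix.det (Matrix.of fun r s : Fin d =>
    if D.a s ≤ (r : ℕ) then
      (((r : ℕ).choose (D.a s) * (D.a s).factorial : ℕ) : ℂ) • X (D.n s, (r : ℕ) - D.a s)
    else 0)

/-- A finite set of `k` natural numbers has sum at least `0 + 1 + … + (k - 1)`. -/
theorem card_sq_le_two_mul_sum_add_card (S : Finset ℕ) :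
    S.card ^ 2 ≤ 2 * ∑ x ∈ S, x + S.card := by
  induction S using Finset.induction_on_max with
  | empty => simp
  | insert m S hm ih =>
    have hmem : m ∉ S := fun h => (hm m h).false
    have hcard : S.card ≤ m := by
      simpa using Finset.card_le_card
        (fun x hx => Finset.mem_range.2 (hm x hx) : S ⊆ Finset.range m)
    rw [Finset.card_insert_of_notMem hmem, Finset.sum_insert hmem]
    linarith

/-- The exponents of a Wronskian datum with `m_i` entries in the `i`-th block satisfy
`∑ i, m_i ^ 2 ≤ 2 * ∑ s, α_s + d`. -/
theorem WronskDatum.sum_sq_card_block_le {N d : ℕ} (D : WronskDatum N d) :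
    ∑ i, (Finset.univ.filter fun s => D.n s = i).card ^ 2 ≤ 2 * ∑ s, D.a s + d := by
  have hblock (i : Fin (N + 1)) :
      (Finset.univ.filter fun s => D.n s = i).card ^ 2 ≤
        2 * ∑ s with D.n s = i, D.a s + (Finset.univ.filter fun s => D.n s = i).card := by
    have hinj : Set.InjOn D.a (Finset.univ.filter fun s => D.n s = i) := by
      intro s hs t ht hst
      simp only [Finset.coe_filter, Finset.mem_univ, true_and, Set.mem_ofPred_eq] at hs ht
      rcases lt_trichotomy s t with h | h | h
      · exact absurd hst (D.strictOnBlocks s t h (hs.trans ht.symm)).ne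
      · exact h
      · exact absurd hst (D.strictOnBlocks t s h (ht.trans hs.symm)).ne'
    simpa [Finset.card_image_of_injOn hinj, Finset.sum_image hinj] using
      card_sq_le_two_mul_sum_add_card ((Finset.univ.filter fun s => D.n s = i).image D.a)
  calc _ ≤ _ := Finset.sum_le_sum fun i _ => hblock i
    _ = 2 * ∑ s, D.a s + d := by
      rw [Finset.sum_add_distrib, ← Finset.mul_sum, Finset.sum_fiberwise,
        ← Finset.card_eq_sum_card_fiberwise (by simp), Finset.card_univ, Fintype.card_fin]

/-- The weight `d(d−1)/2 − (α_1 + … + α_d)` of the Wronskian polynomial `W_𝒫` is at most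
`⌊(1 − 1/(N+1)) · d²/2⌋ = ⌊N·d²/(2(N+1))⌋`. -/
theorem wronskian_weight_le (N d : ℕ) (hN : 1 ≤ N) (hd : 1 ≤ d) (D : WronskDatum N d) :
    d * (d - 1) / 2 - ∑ s, D.a s ≤ N * d ^ 2 / (2 * (N + 1)) := by
  have hcauchy : d ^ 2 ≤
      (N + 1) * ∑ i, (Finset.univ.filter fun s => D.n s = i).card ^ 2 := by
    have hsum : ∑ i, (Finset.univ.filter fun s => D.n s = i).card = d := by
      rw [← Finset.card_eq_sum_card_fiberwise (by simp), Finset.card_univ, Fintype.card_fin]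
    simpa [hsum] using sq_sum_le_card_mul_sum_sq (s := Finset.univ)
      (f := fun i => (Finset.univ.filter fun s => D.n s = i).card)
  have hle := hcauchy.trans (Nat.mul_le_mul_left (N + 1) D.sum_sq_card_block_le)
  rw [Nat.le_div_iff_mul_le (by positivity)]
  rcases le_total (d * (d - 1) / 2) (∑ s, D.a s) with h | h
  · simp [Nat.sub_eq_zero_of_le h]
  · obtain ⟨w, hw⟩ := Nat.exists_eq_add_of_le h
    have hdiv : 2 * (d * (d - 1) / 2) = d * (d - 1) :=
      Nat.mul_div_cancel' (Nat.even_mul_pred_self d).two_dvd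
    have hsq : d * (d - 1) + d = d ^ 2 := by
      obtain ⟨e, rfl⟩ := Nat.exists_eq_add_of_le hd
      simp only [Nat.add_sub_cancel_left]
      ring
    rw [hw, Nat.add_sub_cancel_left]
    rw [hw] at hdiv
    have hmul : (N + 1) * (2 * (∑ s, D.a s + w) + d) = (N + 1) * d ^ 2 := by rw [hdiv, hsq]
    linarith
end
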